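/- arXiv:1804.08252 — 12 statements merged into one kernel-verified Lean document; each statement's English description precedes it below -/
import Mathlib

section
/- Let d and s be positive integers and let Π = (M, P, Q) be a distance-d partition system for Z_n with M = (M_1, …, M_{s+1}), together with a fixed choice function designating a covering position p_σ for each covered permutation. Then the extended array ext(Π) is a set of permutations of Z_{n+1} whose pairwise Hamming distance is at least d, i.e., hd(ext(Π)) ≥ d. -/
/-- Extend a permutation of `Fin n` to a permutation of `Fin (n+1)` fixing the new
last element `n`. -/
def extFix {n : ℕ} (σ : Equiv.Perm (Fin n)) : Equiv.Perm (Fin (n + 1)) :=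
  σ.viaFintypeEmbedding ⟨Fin.castSucc, Fin.castSucc_injective n⟩

/-- The extension `ext_k(σ)` of a permutation `σ` of `Z_n` by position `k`:
it sends `k ↦ n`, `n ↦ σ k`, and `j ↦ σ j` for every other `j < n`. -/
def extPerm {n : ℕ} (σ : Equiv.Perm (Fin n)) (k : Fin n) : Equiv.Perm (Fin (n + 1)) :=
  Equiv.swap (Fin.castSucc (σ k)) (Fin.last n) * extFix σ

/-- A distance-`d` partition system for `Z_n`, together with a fixed choice function
designating a covering position for each covered permutation. -/
structure PartitionSystem (n s d : ℕ) where
  /-- the list `M_1, …, M_{s+1}` of pairwise disjoint sets of permutations -/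
  M : Fin (s + 1) → Finset (Equiv.Perm (Fin n))
  /-- the ordered partition of positions `P_1, …, P_s` -/
  P : Fin s → Finset (Fin n)
  /-- the ordered partition of symbols `Q_1, …, Q_s` -/
  Q : Fin s → Finset (Fin n)
  M_disjoint : ∀ i j, i ≠ j → Disjoint (M i) (M j)
  P_disjoint : ∀ i j, i ≠ j → Disjoint (P i) (P j)
  P_cover : ∀ x : Fin n, ∃ i, x ∈ P i
  Q_disjoint : ∀ i j, i ≠ j → Disjoint (Q i) (Q j)
  Q_cover : ∀ x : Fin n, ∃ i, x ∈ Q i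
  /-- Property (I): `hd(M_i) ≥ d` -/
  hd_intra : ∀ i, ∀ σ ∈ M i, ∀ τ ∈ M i, σ ≠ τ → d ≤ hammingDist ⇑σ ⇑τ
  /-- Property (II): `hd(M_i, M_j) ≥ d − 1` for `i ≠ j` -/
  hd_inter : ∀ i j, i ≠ j → ∀ σ ∈ M i, ∀ τ ∈ M j, d - 1 ≤ hammingDist ⇑σ ⇑τ
  /-- the choice function designating a covering position for each covered permutation -/
  choice : Fin s → Equiv.Perm (Fin n) → Fin n
  choice_spec : ∀ i σ, (∃ p ∈ P i, σ p ∈ Q i) →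
    choice i σ ∈ P i ∧ σ (choice i σ) ∈ Q i

/-- The extended array `ext(Π)`: all `ext_{p_σ}(σ)` for covered `σ ∈ M_i` (`1 ≤ i ≤ s`),
together with the extensions of all `σ ∈ M_{s+1}` by the fixed point `n ↦ n`. -/
def extSet {n s d : ℕ} (Ps : PartitionSystem n s d) :
    Finset (Equiv.Perm (Fin (n + 1))) :=
  ((Finset.univ : Finset (Fin s)).biUnion fun i =>
    ((Ps.M i.castSucc).filter fun σ => ∃ p ∈ Ps.P i, σ p ∈ Ps.Q i).image
      fun σ => extPerm σ (Ps.choice i σ))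
  ∪ (Ps.M (Fin.last s)).image extFix

open Equiv

section HammingDist

variable {ι κ : Type*} [Fintype ι] [Fintype κ]

/-- Hamming distance does not decrease along an injection of positions preserving
disagreement. -/
theorem hammingDist_le_of_injective {α β : Type*} [DecidableEq α] [DecidableEq β]
    {f g : ι → α} {f' g' : κ → β} {e : ι → κ} (he : Function.Injective e)
    (h : ∀ x, f x ≠ g x → f' (e x) ≠ g' (e x)) :
    hammingDist f g ≤ hammingDist f' g' :=
  Finset.card_le_card_of_injOn e (fun x hx => by simpa using h x (by simpa using hx))
    he.injOn

/-- Hamming distance increases along an injection of positions preserving disagreement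
which misses some position of disagreement. -/
theorem hammingDist_lt_of_injective {α β : Type*} [DecidableEq α] [DecidableEq β]
    {f g : ι → α} {f' g' : κ → β} {e : ι → κ} (he : Function.Injective e)
    (h : ∀ x, f x ≠ g x → f' (e x) ≠ g' (e x)) {y : κ} (hy : ∀ x, e x ≠ y)
    (hne : f' y ≠ g' y) :
    hammingDist f g < hammingDist f' g' := by
  classical
  rw [hammingDist, ← Finset.card_image_of_injective _ he]
  refine Finset.card_lt_card (Finset.ssubset_iff.2 ⟨y, by simp [hy], fun z hz => ?_⟩)
  rcases Finset.mem_insert.1 hz with rfl | hz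
  · simpa using hne
  · obtain ⟨x, hx, rfl⟩ := Finset.mem_image.1 hz
    simpa using h x (by simpa using hx)

end HammingDist

section Extension

variable {n : ℕ} (σ : Perm (Fin n)) (k : Fin n)

@[simp]
theorem extFix_castSucc (x : Fin n) : extFix σ x.castSucc = (σ x).castSucc :=
  Perm.viaFintypeEmbedding_apply_image σ ⟨Fin.castSucc, Fin.castSucc_injective n⟩ x

@[simp]
theorem extFix_last : extFix σ (Fin.last n) = Fin.last n :=
  Perm.viaFintypeEmbedding_apply_notMem_range σ _ (by simp)

@[simp]
theorem extPerm_last : extPerm σ k (Fin.last n) = (σ k).castSucc := by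
  simp [extPerm]

@[simp]
theorem extPerm_castSucc_self : extPerm σ k k.castSucc = Fin.last n := by
  simp [extPerm]

theorem extPerm_castSucc_of_ne {x : Fin n} (h : x ≠ k) :
    extPerm σ k x.castSucc = (σ x).castSucc := by
  simp [extPerm, swap_apply_of_ne_of_ne, h, Fin.castSucc_ne_last]

variable {σ k} {τ : Perm (Fin n)} {l : Fin n}

theorem extPerm_castSucc_ne_of_ne (hkl : k ≠ l) {x : Fin n} (hx : σ x ≠ τ x) :
    extPerm σ k x.castSucc ≠ extPerm τ l x.castSucc := by
  rcases eq_or_ne x k with rfl | hxk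
  · simp [extPerm_castSucc_of_ne τ l hkl, (Fin.castSucc_ne_last _).symm]
  rcases eq_or_ne x l with rfl | hxl
  · simp [extPerm_castSucc_of_ne σ k hxk, Fin.castSucc_ne_last]
  simpa [extPerm_castSucc_of_ne _ _ hxk, extPerm_castSucc_of_ne _ _ hxl] using hx

theorem hammingDist_le_extFix : hammingDist ⇑σ ⇑τ ≤ hammingDist ⇑(extFix σ) ⇑(extFix τ) :=
  hammingDist_le_of_injective (Fin.castSucc_injective n) fun x hx => by simpa using hx

theorem hammingDist_le_extPerm :
    hammingDist ⇑σ ⇑τ ≤ hammingDist ⇑(extPerm σ k) ⇑(extPerm τ l) := by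
  rcases eq_or_ne k l with rfl | hkl
  · refine hammingDist_le_of_injective (e := fun x => swap k.castSucc (Fin.last n) x.castSucc)
      ((Equiv.injective _).comp (Fin.castSucc_injective n)) fun x hx => ?_
    rcases eq_or_ne x k with rfl | hxk
    · simpa using hx
    · simpa [swap_apply_of_ne_of_ne, hxk, Fin.castSucc_ne_last,
        extPerm_castSucc_of_ne _ _ hxk] using hx
  · exact hammingDist_le_of_injective (Fin.castSucc_injective n) fun x hx =>
      extPerm_castSucc_ne_of_ne hkl hx

theorem hammingDist_lt_extPerm (hkl : k ≠ l) (hne : σ k ≠ τ l) :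
    hammingDist ⇑σ ⇑τ < hammingDist ⇑(extPerm σ k) ⇑(extPerm τ l) :=
  hammingDist_lt_of_injective (Fin.castSucc_injective n)
    (fun _ hx => extPerm_castSucc_ne_of_ne hkl hx) Fin.castSucc_ne_last (by simpa using hne)

theorem hammingDist_lt_extPerm_extFix :
    hammingDist ⇑σ ⇑τ < hammingDist ⇑(extPerm σ k) ⇑(extFix τ) := by
  refine hammingDist_lt_of_injective (Fin.castSucc_injective n) (fun x hx => ?_)
    Fin.castSucc_ne_last (by simp [Fin.castSucc_ne_last])
  rcases eq_or_ne x k with rfl | hxk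
  · simp [(Fin.castSucc_ne_last _).symm]
  · simpa [extPerm_castSucc_of_ne _ _ hxk] using hx

end Extension

theorem mem_extSet {n s d : ℕ} {Ps : PartitionSystem n s d} {σ' : Perm (Fin (n + 1))} :
    σ' ∈ extSet Ps ↔
      (∃ i, ∃ σ ∈ Ps.M i.castSucc, Ps.choice i σ ∈ Ps.P i ∧ σ (Ps.choice i σ) ∈ Ps.Q i ∧
        extPerm σ (Ps.choice i σ) = σ') ∨
      ∃ σ ∈ Ps.M (Fin.last s), extFix σ = σ' := by
  simp only [extSet, Finset.mem_union, Finset.mem_biUnion, Finset.mem_univ, true_and,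
    Finset.mem_image, Finset.mem_filter]
  refine or_congr_left (exists_congr fun i => exists_congr fun σ => ?_)
  constructor
  · rintro ⟨⟨hσ, hcov⟩, rfl⟩
    exact ⟨hσ, (Ps.choice_spec i σ hcov).1, (Ps.choice_spec i σ hcov).2, rfl⟩
  · rintro ⟨hσ, hP, hQ, rfl⟩
    exact ⟨⟨hσ, _, hP, hQ⟩, rfl⟩

/-- **Theorem (simple partition and extension).** If `d` and `s` are positive and `Π` is a
distance-`d` partition system for `Z_n` (with a fixed choice function), then the extended
array `ext(Π)` is a set of permutations of `Z_{n+1}` with `hd(ext(Π)) ≥ d`. -/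
theorem simple_partition_and_extension {n s d : ℕ} (hdpos : 0 < d) (hspos : 0 < s)
    (Ps : PartitionSystem n s d) :
    ∀ σ' ∈ extSet Ps, ∀ τ' ∈ extSet Ps, σ' ≠ τ' → d ≤ hammingDist ⇑σ' ⇑τ' := by
  intro σ' hσ' τ' hτ' hne
  rcases mem_extSet.1 hσ' with ⟨i, σ, hσ, hσP, hσQ, rfl⟩ | ⟨σ, hσ, rfl⟩ <;>
    rcases mem_extSet.1 hτ' with ⟨j, τ, hτ, hτP, hτQ, rfl⟩ | ⟨τ, hτ, rfl⟩
  · rcases eq_or_ne i j with rfl | hij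
    · refine (Ps.hd_intra _ σ hσ τ hτ ?_).trans hammingDist_le_extPerm
      rintro rfl
      exact hne rfl
    · have hdist := Ps.hd_inter _ _ ((Fin.castSucc_injective s).ne hij) σ hσ τ hτ
      have hlt := hammingDist_lt_extPerm
        (Finset.disjoint_iff_ne.1 (Ps.P_disjoint i j hij) _ hσP _ hτP)
        (Finset.disjoint_iff_ne.1 (Ps.Q_disjoint i j hij) _ hσQ _ hτQ)
      omega
  · have hdist := Ps.hd_inter _ _ (Fin.castSucc_ne_last i) σ hσ τ hτ
    have hlt := hammingDist_lt_extPerm_extFix (σ := σ) (τ := τ) (k := Ps.choice i σ)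
    omega
  · have hdist := Ps.hd_inter _ _ (Fin.castSucc_ne_last j) τ hτ σ hσ
    have hlt := hammingDist_lt_extPerm_extFix (σ := τ) (τ := σ) (k := Ps.choice j τ)
    rw [hammingDist_comm]
    omega
  · refine (Ps.hd_intra _ σ hσ τ hτ ?_).trans hammingDist_le_extFix
    rintro rfl
    exact hne rfl
end

section
/- Rudimentary parallel partition and extension: let n ≥ r ≥ 1 and let A be a set of permutations of Z_n that is the disjoint union of 2r blocks B_0, B_1, …, B_{2r−1} such that hd(B_i) ≥ d for every i and hd(A) ≥ d−r. Let A' = ⋃_{l=0}^{r−1} {σ'_l : σ ∈ B_l} ∪ ⋃_{m=r}^{2r−1} {σ''_m : σ ∈ B_m}. Then A' is a set of permutations of Z_{n+r} with hd(A') ≥ d and |A'| = Σ_{i=0}^{2r−1} |B_i|; in particular there exists a set of Σ_{i=0}^{2r−1} |B_i| permutations of Z_{n+r} with pairwise Hamming distance at least d (i.e., M(n+r, d) ≥ Σ_{i=0}^{2r−1} |B_i|). -/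
theorem hammingDist_fin_add {α : Type*} [DecidableEq α] {a b : ℕ} (f g : Fin (a + b) → α) :
    hammingDist f g =
      hammingDist (fun i => f (Fin.castAdd b i)) (fun i => g (Fin.castAdd b i)) +
      hammingDist (fun i => f (Fin.natAdd a i)) (fun i => g (Fin.natAdd a i)) := by
  simp only [hammingDist, Finset.card_filter, Fin.sum_univ_add]

theorem hammingDist_eq_card {ι α : Type*} [Fintype ι] [DecidableEq α] {f g : ι → α}
    (h : ∀ i, f i ≠ g i) : hammingDist f g = Fintype.card ι := by
  simp [hammingDist, h, Finset.card_univ]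

theorem hammingDist_castAdd_comp {ι : Type*} [Fintype ι] {n : ℕ} (r : ℕ) (f g : ι → Fin n) :
    hammingDist (fun i => Fin.castAdd r (f i)) (fun i => Fin.castAdd r (g i)) =
      hammingDist f g :=
  hammingDist_comp (fun _ => Fin.castAdd r) fun _ => Fin.castAdd_injective n r

theorem eq_of_add_mod_eq {r i j k : ℕ} (h : (i + k) % r = (j + k) % r) (hi : i < 2 * r)
    (hj : j < 2 * r) (hij : i < r ↔ j < r) : i = j := by
  have h' : i % r = j % r := Nat.ModEq.add_right_cancel' k h
  by_cases hir : i < r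
  · rwa [Nat.mod_eq_of_lt hir, Nat.mod_eq_of_lt (hij.1 hir)] at h'
  · have hjr : ¬ j < r := fun hj => hir (hij.2 hj)
    rw [Nat.mod_eq_sub_mod (by omega), Nat.mod_eq_sub_mod (a := j) (by omega),
      Nat.mod_eq_of_lt (by omega), Nat.mod_eq_of_lt (by omega)] at h'
    omega

/-- The extensions `E i` preserve Hamming distance, and extensions with different indices
are farther apart than the original permutations by at least `r`. -/
theorem hammingDist_extension {m r : ℕ} (hr : 1 ≤ r)
    (E : Fin (2 * r) → Equiv.Perm (Fin (r + m)) → Equiv.Perm (Fin (r + m + r)))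
    (hE_first : ∀ (i : Fin (2 * r)) (σ : Equiv.Perm (Fin (r + m))), (i : ℕ) < r →
      (∀ j : Fin r, E i σ (Fin.castAdd r (Fin.castAdd m j)) =
        Fin.natAdd (r + m) ⟨((i : ℕ) + (j : ℕ)) % r, Nat.mod_lt _ hr⟩) ∧
      (∀ j : Fin m, E i σ (Fin.castAdd r (Fin.natAdd r j)) =
        Fin.castAdd r (σ (Fin.natAdd r j))) ∧
      (∀ j : Fin r, E i σ (Fin.natAdd (r + m) j) = Fin.castAdd r (σ (Fin.castAdd m j))))
    (hE_second : ∀ (i : Fin (2 * r)) (σ : Equiv.Perm (Fin (r + m))), r ≤ (i : ℕ) →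
      (∀ j : Fin (r + m), E i σ (Fin.castAdd r j) = Fin.castAdd r (σ j)) ∧
      (∀ j : Fin r, E i σ (Fin.natAdd (r + m) j) =
        Fin.natAdd (r + m) ⟨((i : ℕ) + (j : ℕ)) % r, Nat.mod_lt _ hr⟩))
    (i j : Fin (2 * r)) (σ τ : Equiv.Perm (Fin (r + m))) :
    (i = j → hammingDist ⇑(E i σ) ⇑(E j τ) = hammingDist ⇑σ ⇑τ) ∧
    (i ≠ j → hammingDist ⇑σ ⇑τ + r ≤ hammingDist ⇑(E i σ) ⇑(E j τ)) := by
  have hne (a : Fin (r + m)) (b : Fin r) : Fin.castAdd r a ≠ Fin.natAdd (r + m) b := by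
    simp only [ne_eq, Fin.ext_iff, Fin.val_castAdd, Fin.val_natAdd]
    omega
  have hshift (hij : i ≠ j) (hlt : (i : ℕ) < r ↔ (j : ℕ) < r) (k : Fin r) :
      Fin.natAdd (r + m) (⟨((i : ℕ) + k) % r, Nat.mod_lt _ hr⟩ : Fin r) ≠
        Fin.natAdd (r + m) ⟨((j : ℕ) + k) % r, Nat.mod_lt _ hr⟩ := fun h => by
    simp only [Fin.ext_iff, Fin.val_natAdd, Nat.add_left_cancel_iff] at h
    exact hij (Fin.ext (eq_of_add_mod_eq h i.isLt j.isLt hlt))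
  have hle : hammingDist (fun k => σ (Fin.castAdd m k)) (fun k => τ (Fin.castAdd m k)) ≤ r := by
    simpa using hammingDist_le_card_fintype
      (x := fun k => σ (Fin.castAdd m k)) (y := fun k => τ (Fin.castAdd m k))
  rw [hammingDist_fin_add ⇑(E i σ), hammingDist_fin_add (fun k => E i σ (Fin.castAdd r k)),
    hammingDist_fin_add ⇑σ]
  by_cases hi : (i : ℕ) < r <;> by_cases hj : (j : ℕ) < r
  · obtain ⟨a, b, c⟩ := hE_first i σ hi
    obtain ⟨a', b', c'⟩ := hE_first j τ hj
    simp only [a, b, c, a', b', c', hammingDist_castAdd_comp]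
    refine ⟨fun h => ?_, fun h => ?_⟩
    · subst h
      rw [hammingDist_self]
      omega
    · rw [hammingDist_eq_card (hshift h (by tauto)), Fintype.card_fin]
      omega
  · obtain ⟨a, b, c⟩ := hE_first i σ hi
    obtain ⟨a', c'⟩ := hE_second j τ (not_lt.1 hj)
    simp only [a, b, c, a', c', hammingDist_castAdd_comp]
    refine ⟨fun h => absurd (h ▸ hi) hj, fun _ => ?_⟩
    rw [hammingDist_eq_card fun k => (hne _ _).symm, hammingDist_eq_card fun k => hne _ _,
      Fintype.card_fin]
    omega
  · obtain ⟨a, c⟩ := hE_second i σ (not_lt.1 hi)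
    obtain ⟨a', b', c'⟩ := hE_first j τ hj
    simp only [a, c, a', b', c', hammingDist_castAdd_comp]
    refine ⟨fun h => absurd (h ▸ hj) hi, fun _ => ?_⟩
    rw [hammingDist_eq_card fun k => hne _ _, hammingDist_eq_card fun k => (hne _ _).symm,
      Fintype.card_fin]
    omega
  · obtain ⟨a, c⟩ := hE_second i σ (not_lt.1 hi)
    obtain ⟨a', c'⟩ := hE_second j τ (not_lt.1 hj)
    simp only [a, c, a', c', hammingDist_castAdd_comp]
    refine ⟨fun h => ?_, fun h => ?_⟩
    · subst h
      rw [hammingDist_self]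
      omega
    · rw [hammingDist_eq_card (hshift h (by tauto)), Fintype.card_fin]

/-- **Theorem (rudimentary parallel partition and extension).**
Let `n ≥ r ≥ 1` and let `A` be a set of permutations of `Z_n` that is the disjoint union
of `2r` blocks `B_0, …, B_{2r−1}` with `hd(B_i) ≥ d` for every `i` and `hd(A) ≥ d−r`.
For `0 ≤ i < r`, the extension `E i σ` of `σ ∈ B_i` is the permutation `σ'_i` of `Z_{n+r}`
sending `j ↦ n + ((i+j) mod r)` for `j < r`, `j ↦ σ j` for `r ≤ j < n`, and
`n + j ↦ σ j` for `j < r` (the displaced symbols are moved to the end in their original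
order); for `r ≤ i < 2r`, `E i σ` is the permutation `σ''_i` sending `j ↦ σ j` for `j < n`
and `n + j ↦ n + ((i+j) mod r)` for `j < r` (the shifted new symbols are appended).
Then `A' = ⋃_i E i '' B_i` is a set of permutations of `Z_{n+r}` with
`|A'| = Σ_i |B_i|` and `hd(A') ≥ d`; in particular `M(n+r, d) ≥ Σ_i |B_i|`. -/
theorem rudimentary_parallel_partition_and_extension {n r d : ℕ}
    (hr : 1 ≤ r) (hrn : r ≤ n)
    (B : Fin (2 * r) → Finset (Equiv.Perm (Fin n)))
    (hB_disjoint : ∀ i j, i ≠ j → Disjoint (B i) (B j))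
    (hB_intra : ∀ i, ∀ σ ∈ B i, ∀ τ ∈ B i, σ ≠ τ → d ≤ hammingDist ⇑σ ⇑τ)
    (hA : ∀ i j, ∀ σ ∈ B i, ∀ τ ∈ B j, σ ≠ τ → d - r ≤ hammingDist ⇑σ ⇑τ)
    (E : Fin (2 * r) → Equiv.Perm (Fin n) → Equiv.Perm (Fin (n + r)))
    (hE_first : ∀ (i : Fin (2 * r)) (σ : Equiv.Perm (Fin n)), (i : ℕ) < r →
      (∀ j : Fin r, E i σ (Fin.castAdd r (Fin.castLE hrn j)) =
        Fin.natAdd n ⟨((i : ℕ) + (j : ℕ)) % r, Nat.mod_lt _ hr⟩) ∧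
      (∀ j : Fin n, r ≤ (j : ℕ) → E i σ (Fin.castAdd r j) = Fin.castAdd r (σ j)) ∧
      (∀ j : Fin r, E i σ (Fin.natAdd n j) = Fin.castAdd r (σ (Fin.castLE hrn j))))
    (hE_second : ∀ (i : Fin (2 * r)) (σ : Equiv.Perm (Fin n)), r ≤ (i : ℕ) →
      (∀ j : Fin n, E i σ (Fin.castAdd r j) = Fin.castAdd r (σ j)) ∧
      (∀ j : Fin r, E i σ (Fin.natAdd n j) =
        Fin.natAdd n ⟨((i : ℕ) + (j : ℕ)) % r, Nat.mod_lt _ hr⟩)) :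
    ((Finset.univ.biUnion fun i => (B i).image (E i)).card = ∑ i, (B i).card) ∧
    (∀ σ' ∈ Finset.univ.biUnion fun i => (B i).image (E i),
      ∀ τ' ∈ Finset.univ.biUnion fun i => (B i).image (E i),
        σ' ≠ τ' → d ≤ hammingDist ⇑σ' ⇑τ') ∧
    (∃ S : Finset (Equiv.Perm (Fin (n + r))), S.card = ∑ i, (B i).card ∧
      ∀ σ ∈ S, ∀ τ ∈ S, σ ≠ τ → d ≤ hammingDist ⇑σ ⇑τ) := by
  obtain ⟨m, rfl⟩ := Nat.exists_eq_add_of_le hrn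
  have key := hammingDist_extension hr E
    (fun i σ hi => ⟨(hE_first i σ hi).1,
      fun j => (hE_first i σ hi).2.1 _ (Nat.le_add_right r j), (hE_first i σ hi).2.2⟩)
    hE_second
  have hcard : (Finset.univ.biUnion fun i => (B i).image (E i)).card = ∑ i, (B i).card := by
    rw [Finset.card_biUnion]
    · refine Finset.sum_congr rfl fun i _ => Finset.card_image_of_injective _ fun σ τ h => ?_
      have := (key i i σ τ).1 rfl
      rw [h, hammingDist_self] at this
      exact DFunLike.coe_injective (hammingDist_eq_zero.1 this.symm)
    · intro i _ j _ hij
      simp only [Finset.disjoint_left, Finset.mem_image, not_exists, not_and]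
      rintro _ ⟨σ, -, rfl⟩ τ - h
      have := (key i j σ τ).2 hij
      rw [h, hammingDist_self] at this
      omega
  have hdist : ∀ σ' ∈ Finset.univ.biUnion fun i => (B i).image (E i),
      ∀ τ' ∈ Finset.univ.biUnion fun i => (B i).image (E i),
        σ' ≠ τ' → d ≤ hammingDist ⇑σ' ⇑τ' := by
    simp only [Finset.mem_biUnion, Finset.mem_univ, true_and, Finset.mem_image]
    rintro _ ⟨i, σ, hσ, rfl⟩ _ ⟨j, τ, hτ, rfl⟩ h
    by_cases hij : i = j
    · subst hij
      rw [(key i i σ τ).1 rfl]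
      exact hB_intra i σ hσ τ hτ fun e => h (e ▸ rfl)
    · have h₁ := (key i j σ τ).2 hij
      have h₂ := hA i j σ hσ τ hτ (Finset.disjoint_iff_ne.1 (hB_disjoint i j hij) σ hσ τ hτ)
      omega
  exact ⟨hcard, hdist, _, hcard, hdist⟩
end

section
/- Parallel partition and extension with two symbols: let d be a positive integer and let Π = (M, P, Q, R, S) be a (d,2)-partition system for Z_n with M = (M_1, …, M_{s+2}) for some positive integer s, together with a fixed choice function designating a covering pair (p_σ, r_σ) for each 2-covered permutation σ. Then 2-ext(Π) is a set of permutations of Z_{n+2} with hd(2-ext(Π)) ≥ d. -/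
/-- Extend a permutation of `Fin n` to a permutation of `Fin (n+2)` fixing the two new
elements `n` and `n+1`. -/
def extFix2 {n : ℕ} (σ : Equiv.Perm (Fin n)) : Equiv.Perm (Fin (n + 2)) :=
  σ.viaFintypeEmbedding ⟨Fin.castLE (by omega), Fin.castLE_injective _⟩

/-- The parallel extension `2-ext(σ)` of a permutation `σ` of `Z_n` by the pair of
positions `(p, r)`: it sends `p ↦ n`, `n ↦ σ p`, `r ↦ n+1`, `n+1 ↦ σ r`, and
`j ↦ σ j` for every `j < n` with `j ∉ {p, r}`. -/
def ext2Perm {n : ℕ} (σ : Equiv.Perm (Fin n)) (p r : Fin n) : Equiv.Perm (Fin (n + 2)) :=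
  Equiv.swap (Fin.castLE (by omega) (σ r)) (Fin.last (n + 1)) *
    (Equiv.swap (Fin.castLE (by omega) (σ p)) (Fin.castSucc (Fin.last n)) * extFix2 σ)

/-- A `(d,2)`-partition system for `Z_n`, together with a fixed choice function
designating a covering pair of positions for each 2-covered permutation. -/
structure PartitionSystem2 (n s d : ℕ) where
  /-- the list `M_1, …, M_{s+2}` of pairwise disjoint sets of permutations -/
  M : Fin (s + 2) → Finset (Equiv.Perm (Fin n))
  /-- the first ordered partition of positions `P_1, …, P_s` -/
  P : Fin s → Finset (Fin n)
  /-- the first ordered partition of symbols `Q_1, …, Q_s` -/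
  Q : Fin s → Finset (Fin n)
  /-- the second ordered partition of positions `R_1, …, R_s` -/
  R : Fin s → Finset (Fin n)
  /-- the second ordered partition of symbols `S_1, …, S_s` -/
  S : Fin s → Finset (Fin n)
  M_disjoint : ∀ i j, i ≠ j → Disjoint (M i) (M j)
  P_disjoint : ∀ i j, i ≠ j → Disjoint (P i) (P j)
  P_cover : ∀ x : Fin n, ∃ i, x ∈ P i
  Q_disjoint : ∀ i j, i ≠ j → Disjoint (Q i) (Q j)
  Q_cover : ∀ x : Fin n, ∃ i, x ∈ Q i
  R_disjoint : ∀ i j, i ≠ j → Disjoint (R i) (R j)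
  R_cover : ∀ x : Fin n, ∃ i, x ∈ R i
  S_disjoint : ∀ i j, i ≠ j → Disjoint (S i) (S j)
  S_cover : ∀ x : Fin n, ∃ i, x ∈ S i
  PR_disjoint : ∀ i, Disjoint (P i) (R i)
  QS_disjoint : ∀ i, Disjoint (Q i) (S i)
  /-- Property (I): `hd(M_i) ≥ d` -/
  hd_intra : ∀ i, ∀ σ ∈ M i, ∀ τ ∈ M i, σ ≠ τ → d ≤ hammingDist ⇑σ ⇑τ
  /-- Property (II): `hd(M_i, M_j) ≥ d − 2` for `i ≠ j` -/
  hd_inter : ∀ i j, i ≠ j → ∀ σ ∈ M i, ∀ τ ∈ M j, d - 2 ≤ hammingDist ⇑σ ⇑τ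
  /-- the choice of the first covering position `p_σ` -/
  choiceP : Fin s → Equiv.Perm (Fin n) → Fin n
  /-- the choice of the second covering position `r_σ` -/
  choiceR : Fin s → Equiv.Perm (Fin n) → Fin n
  choice_spec : ∀ i σ,
    (∃ p ∈ P i, ∃ r ∈ R i, p ≠ r ∧ σ p ∈ Q i ∧ σ r ∈ S i) →
      choiceP i σ ∈ P i ∧ choiceR i σ ∈ R i ∧ choiceP i σ ≠ choiceR i σ ∧
        σ (choiceP i σ) ∈ Q i ∧ σ (choiceR i σ) ∈ S i

/-- The extended array `2-ext(Π)`: all `2-ext(σ)` for 2-covered `σ ∈ M_i` (`1 ≤ i ≤ s`),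
together with the extensions of all `σ ∈ M_{s+1}` by `n ↦ n, n+1 ↦ n+1` and of all
`σ ∈ M_{s+2}` by `n ↦ n+1, n+1 ↦ n`. -/
def ext2Set {n s d : ℕ} (Ps : PartitionSystem2 n s d) :
    Finset (Equiv.Perm (Fin (n + 2))) :=
  ((Finset.univ : Finset (Fin s)).biUnion fun i =>
    ((Ps.M (i.castSucc.castSucc)).filter fun σ =>
        ∃ p ∈ Ps.P i, ∃ r ∈ Ps.R i, p ≠ r ∧ σ p ∈ Ps.Q i ∧ σ r ∈ Ps.S i).image
      fun σ => ext2Perm σ (Ps.choiceP i σ) (Ps.choiceR i σ))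
  ∪ (Ps.M ((Fin.last s).castSucc)).image extFix2
  ∪ (Ps.M (Fin.last (s + 1))).image
      (fun σ => Equiv.swap (Fin.castSucc (Fin.last n)) (Fin.last (n + 1)) * extFix2 σ)

theorem extFix2_castSucc_castSucc {n : ℕ} (σ : Equiv.Perm (Fin n)) (x : Fin n) :
    extFix2 σ x.castSucc.castSucc = (σ x).castSucc.castSucc :=
  Equiv.Perm.viaFintypeEmbedding_apply_image σ
    ⟨Fin.castLE (by omega), Fin.castLE_injective (show n ≤ n + 2 by omega)⟩ x

theorem extFix2_castSucc_last {n : ℕ} (σ : Equiv.Perm (Fin n)) :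
    extFix2 σ (Fin.last n).castSucc = (Fin.last n).castSucc := by
  apply Equiv.Perm.viaFintypeEmbedding_apply_notMem_range
  rintro ⟨x, hx⟩
  have := congrArg Fin.val hx
  have := x.isLt
  simp at *
  omega

theorem extFix2_last {n : ℕ} (σ : Equiv.Perm (Fin n)) :
    extFix2 σ (Fin.last (n + 1)) = Fin.last (n + 1) := by
  apply Equiv.Perm.viaFintypeEmbedding_apply_notMem_range
  rintro ⟨x, hx⟩
  have := congrArg Fin.val hx
  have := x.isLt
  simp at *
  omega

theorem ext2Perm_castSucc_castSucc {n : ℕ} (σ : Equiv.Perm (Fin n)) (p r x : Fin n) :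
    ext2Perm σ p r x.castSucc.castSucc =
      if x = p then (Fin.last n).castSucc
      else if x = r then Fin.last (n + 1) else (σ x).castSucc.castSucc := by
  change Equiv.swap (σ r).castSucc.castSucc _ (Equiv.swap (σ p).castSucc.castSucc _
    (extFix2 σ _)) = _
  rw [extFix2_castSucc_castSucc]
  simp only [Equiv.swap_apply_def]
  grind [Fin.castSucc_inj, Fin.castSucc_ne_last, σ.injective.eq_iff]

theorem ext2Perm_castSucc_last {n : ℕ} (σ : Equiv.Perm (Fin n)) {p r : Fin n} (h : p ≠ r) :
    ext2Perm σ p r (Fin.last n).castSucc = (σ p).castSucc.castSucc := by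
  change Equiv.swap (σ r).castSucc.castSucc _ (Equiv.swap (σ p).castSucc.castSucc _
    (extFix2 σ _)) = _
  rw [extFix2_castSucc_last]
  simp only [Equiv.swap_apply_def]
  grind [Fin.castSucc_inj, Fin.castSucc_ne_last, σ.injective.eq_iff]

theorem ext2Perm_last {n : ℕ} (σ : Equiv.Perm (Fin n)) (p r : Fin n) :
    ext2Perm σ p r (Fin.last (n + 1)) = (σ r).castSucc.castSucc := by
  change Equiv.swap (σ r).castSucc.castSucc _ (Equiv.swap (σ p).castSucc.castSucc _
    (extFix2 σ _)) = _
  rw [extFix2_last]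
  simp only [Equiv.swap_apply_def]
  grind [Fin.castSucc_inj, Fin.castSucc_ne_last]

/-- The Hamming distance of two maps on `Fin (n + 2)`, split off at the last two positions. -/
theorem hammingDist_fin_add_two {n : ℕ} {α : Type*} [DecidableEq α] (f g : Fin (n + 2) → α) :
    hammingDist f g =
      hammingDist (fun x : Fin n => f x.castSucc.castSucc) (fun x => g x.castSucc.castSucc)
        + (if f (Fin.last n).castSucc ≠ g (Fin.last n).castSucc then 1 else 0)
        + (if f (Fin.last (n + 1)) ≠ g (Fin.last (n + 1)) then 1 else 0) := by
  simp only [hammingDist, Finset.card_filter, Fin.sum_univ_castSucc]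

/-- If an extension keeps all differing positions and the new positions differ as well, the
Hamming distance grows by at least two. -/
theorem hammingDist_add_two_le {n : ℕ} {α β : Type*} [DecidableEq α] [DecidableEq β]
    {f g : Fin (n + 2) → α} {f₀ g₀ : Fin n → β}
    (h : ∀ x, f₀ x ≠ g₀ x → f x.castSucc.castSucc ≠ g x.castSucc.castSucc)
    (h₁ : f (Fin.last n).castSucc ≠ g (Fin.last n).castSucc)
    (h₂ : f (Fin.last (n + 1)) ≠ g (Fin.last (n + 1))) :
    hammingDist f₀ g₀ + 2 ≤ hammingDist f g := by
  rw [hammingDist_fin_add_two f g, if_pos h₁, if_pos h₂]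
  have : hammingDist f₀ g₀ ≤ hammingDist (fun x : Fin n => f x.castSucc.castSucc)
      (fun x => g x.castSucc.castSucc) :=
    Finset.card_le_card (Finset.monotone_filter_right _ fun x _ hx => h x hx)
  omega

/-- Extending two permutations by pairs of positions that do not interact across the two new
symbols does not decrease the Hamming distance. -/
theorem hammingDist_le_ext2Perm {n : ℕ} (σ τ : Equiv.Perm (Fin n)) {p r q t : Fin n}
    (hpr : p ≠ r) (hqt : q ≠ t) (hpt : p ≠ t) (hqr : q ≠ r) :
    hammingDist ⇑σ ⇑τ ≤ hammingDist ⇑(ext2Perm σ p r) ⇑(ext2Perm τ q t) := by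
  rw [hammingDist_fin_add_two]
  simp only [ext2Perm_castSucc_last _ hpr, ext2Perm_castSucc_last _ hqt, ext2Perm_last,
    ext2Perm_castSucc_castSucc, ne_eq, Fin.castSucc_inj]
  set f : Fin n → Fin (n + 2) := fun x => if x = p then (Fin.last n).castSucc
      else if x = r then Fin.last (n + 1) else (σ x).castSucc.castSucc with hf
  set g : Fin n → Fin (n + 2) := fun x => if x = q then (Fin.last n).castSucc
      else if x = t then Fin.last (n + 1) else (τ x).castSucc.castSucc with hg
  have hsub : ({x | σ x ≠ τ x} : Finset (Fin n)) ⊆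
      (({x | f x ≠ g x} : Finset (Fin n)) ∪ if ¬σ p = τ q then {p} else ∅) ∪
        if ¬σ r = τ t then {r} else ∅ := by
    intro x hx
    have hx : σ x ≠ τ x := by simpa using hx
    by_cases hfg : f x = g x
    · simp only [hf, hg] at hfg
      grind [Fin.castSucc_inj, Fin.castSucc_ne_last]
    · simp [hfg]
  refine (Finset.card_le_card hsub).trans ((Finset.card_union_le _ _).trans ?_)
  refine add_le_add ((Finset.card_union_le _ _).trans (add_le_add le_rfl ?_)) ?_ <;>
    split_ifs <;> simp

theorem hammingDist_extFix2 {n : ℕ} (σ τ : Equiv.Perm (Fin n)) :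
    hammingDist ⇑(extFix2 σ) ⇑(extFix2 τ) = hammingDist ⇑σ ⇑τ := by
  rw [hammingDist_fin_add_two]
  simp only [extFix2_castSucc_castSucc, extFix2_castSucc_last, extFix2_last]
  simp [hammingDist]

theorem hammingDist_mul_left {α : Type*} [Fintype α] [DecidableEq α] (π σ τ : Equiv.Perm α) :
    hammingDist ⇑(π * σ) ⇑(π * τ) = hammingDist ⇑σ ⇑τ := by
  simp [hammingDist]

theorem swap_mul_extFix2_castSucc_castSucc {n : ℕ} (σ : Equiv.Perm (Fin n)) (x : Fin n) :
    (Equiv.swap (Fin.castSucc (Fin.last n)) (Fin.last (n + 1)) * extFix2 σ)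
      x.castSucc.castSucc = (σ x).castSucc.castSucc := by
  rw [Equiv.Perm.mul_apply, extFix2_castSucc_castSucc]
  apply Equiv.swap_apply_of_ne_of_ne
  · simp
  · exact Fin.castSucc_ne_last _

theorem swap_mul_extFix2_castSucc_last {n : ℕ} (σ : Equiv.Perm (Fin n)) :
    (Equiv.swap (Fin.castSucc (Fin.last n)) (Fin.last (n + 1)) * extFix2 σ)
      (Fin.last n).castSucc = Fin.last (n + 1) := by
  rw [Equiv.Perm.mul_apply, extFix2_castSucc_last, Equiv.swap_apply_left]

theorem swap_mul_extFix2_last {n : ℕ} (σ : Equiv.Perm (Fin n)) :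
    (Equiv.swap (Fin.castSucc (Fin.last n)) (Fin.last (n + 1)) * extFix2 σ)
      (Fin.last (n + 1)) = (Fin.last n).castSucc := by
  rw [Equiv.Perm.mul_apply, extFix2_last, Equiv.swap_apply_right]

/-- Extending by pairs of positions, with the positions and the symbols at each new symbol
distinct, increases the Hamming distance by at least two. -/
theorem hammingDist_add_two_le_ext2Perm {n : ℕ} (σ τ : Equiv.Perm (Fin n)) {p r q t : Fin n}
    (hpr : p ≠ r) (hqt : q ≠ t) (hpq : p ≠ q) (hrt : r ≠ t) (h₁ : σ p ≠ τ q) (h₂ : σ r ≠ τ t) :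
    hammingDist ⇑σ ⇑τ + 2 ≤ hammingDist ⇑(ext2Perm σ p r) ⇑(ext2Perm τ q t) := by
  apply hammingDist_add_two_le
  · intro x hx
    rw [ext2Perm_castSucc_castSucc, ext2Perm_castSucc_castSucc]
    grind [Fin.castSucc_inj, Fin.castSucc_ne_last]
  · simpa [ext2Perm_castSucc_last, hpr, hqt] using h₁
  · simpa [ext2Perm_last] using h₂

theorem hammingDist_ext2Perm_extFix2 {n : ℕ} (σ τ : Equiv.Perm (Fin n)) {p r : Fin n}
    (hpr : p ≠ r) :
    hammingDist ⇑σ ⇑τ + 2 ≤ hammingDist ⇑(ext2Perm σ p r) ⇑(extFix2 τ) := by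
  apply hammingDist_add_two_le
  · intro x hx
    rw [ext2Perm_castSucc_castSucc, extFix2_castSucc_castSucc]
    grind [Fin.castSucc_inj, Fin.castSucc_ne_last]
  · simp [ext2Perm_castSucc_last, hpr, extFix2_castSucc_last]
  · simp [ext2Perm_last, extFix2_last]

theorem hammingDist_ext2Perm_swap_mul_extFix2 {n : ℕ} (σ τ : Equiv.Perm (Fin n)) {p r : Fin n}
    (hpr : p ≠ r) :
    hammingDist ⇑σ ⇑τ + 2 ≤ hammingDist ⇑(ext2Perm σ p r)
      ⇑(Equiv.swap (Fin.castSucc (Fin.last n)) (Fin.last (n + 1)) * extFix2 τ) := by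
  apply hammingDist_add_two_le
  · intro x hx
    rw [ext2Perm_castSucc_castSucc, swap_mul_extFix2_castSucc_castSucc]
    grind [Fin.castSucc_inj, Fin.castSucc_ne_last]
  · rw [ext2Perm_castSucc_last _ hpr, swap_mul_extFix2_castSucc_last]
    exact Fin.castSucc_ne_last _
  · rw [ext2Perm_last, swap_mul_extFix2_last]
    simp

theorem hammingDist_extFix2_swap_mul_extFix2 {n : ℕ} (σ τ : Equiv.Perm (Fin n)) :
    hammingDist ⇑σ ⇑τ + 2 ≤ hammingDist ⇑(extFix2 σ)
      ⇑(Equiv.swap (Fin.castSucc (Fin.last n)) (Fin.last (n + 1)) * extFix2 τ) := by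
  apply hammingDist_add_two_le
  · intro x hx
    rw [extFix2_castSucc_castSucc, swap_mul_extFix2_castSucc_castSucc]
    simpa using hx
  · rw [extFix2_castSucc_last, swap_mul_extFix2_castSucc_last]
    exact Fin.castSucc_ne_last _
  · rw [extFix2_last, swap_mul_extFix2_last]
    exact (Fin.castSucc_ne_last _).symm

theorem mem_ext2Set {n s d : ℕ} {Ps : PartitionSystem2 n s d} {π : Equiv.Perm (Fin (n + 2))}
    (h : π ∈ ext2Set Ps) :
    (∃ i, ∃ σ ∈ Ps.M i.castSucc.castSucc,
      (Ps.choiceP i σ ∈ Ps.P i ∧ Ps.choiceR i σ ∈ Ps.R i ∧ Ps.choiceP i σ ≠ Ps.choiceR i σ ∧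
        σ (Ps.choiceP i σ) ∈ Ps.Q i ∧ σ (Ps.choiceR i σ) ∈ Ps.S i) ∧
      π = ext2Perm σ (Ps.choiceP i σ) (Ps.choiceR i σ)) ∨
    (∃ σ ∈ Ps.M (Fin.last s).castSucc, π = extFix2 σ) ∨
    (∃ σ ∈ Ps.M (Fin.last (s + 1)),
      π = Equiv.swap (Fin.castSucc (Fin.last n)) (Fin.last (n + 1)) * extFix2 σ) := by
  simp only [ext2Set, Finset.mem_union, Finset.mem_biUnion, Finset.mem_univ, true_and,
    Finset.mem_image, Finset.mem_filter] at h
  rcases h with (⟨i, σ, ⟨hσ, hc⟩, rfl⟩ | ⟨σ, hσ, rfl⟩) | ⟨σ, hσ, rfl⟩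
  · exact .inl ⟨i, σ, hσ, Ps.choice_spec i σ hc, rfl⟩
  · exact .inr (.inl ⟨σ, hσ, rfl⟩)
  · exact .inr (.inr ⟨σ, hσ, rfl⟩)

/-- **Theorem (parallel partition and extension with two symbols).**
If `d` is a positive integer and `Π` is a `(d,2)`-partition system for `Z_n` (with a fixed
choice function), then `2-ext(Π)` is a set of permutations of `Z_{n+2}` with
`hd(2-ext(Π)) ≥ d`. -/
theorem parallel_partition_and_extension_two {n s d : ℕ} (hdpos : 0 < d) (hspos : 0 < s)
    (Ps : PartitionSystem2 n s d) :
    ∀ σ' ∈ ext2Set Ps, ∀ τ' ∈ ext2Set Ps, σ' ≠ τ' → d ≤ hammingDist ⇑σ' ⇑τ' := by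
  have inter : ∀ {i j}, i ≠ j → ∀ {σ}, σ ∈ Ps.M i → ∀ {τ}, τ ∈ Ps.M j →
      d ≤ hammingDist ⇑σ ⇑τ + 2 := fun hij σ hσ τ hτ => by
    have := Ps.hd_inter _ _ hij σ hσ τ hτ
    omega
  have hfix : ∀ i : Fin s, i.castSucc.castSucc ≠ (Fin.last s).castSucc := fun i => by
    simp
  have hswap : ∀ i : Fin (s + 1), i.castSucc ≠ Fin.last (s + 1) := Fin.castSucc_ne_last
  intro σ' hσ' τ' hτ' hne
  rcases mem_ext2Set hσ' with ⟨i, σ, hσ, ⟨hp, hr, hpr, hσp, hσr⟩, rfl⟩ | ⟨σ, hσ, rfl⟩ |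
      ⟨σ, hσ, rfl⟩ <;>
    rcases mem_ext2Set hτ' with ⟨j, τ, hτ, ⟨hq, ht, hqt, hτq, hτt⟩, rfl⟩ | ⟨τ, hτ, rfl⟩ |
      ⟨τ, hτ, rfl⟩
  · by_cases hij : i = j
    · subst hij
      have hστ : σ ≠ τ := by rintro rfl; exact hne rfl
      exact (Ps.hd_intra _ σ hσ τ hτ hστ).trans <| hammingDist_le_ext2Perm σ τ hpr hqt
        (Finset.disjoint_iff_ne.1 (Ps.PR_disjoint i) _ hp _ ht)
        (Finset.disjoint_iff_ne.1 (Ps.PR_disjoint i) _ hq _ hr)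
    · exact (inter (by simpa using hij) hσ hτ).trans <|
        hammingDist_add_two_le_ext2Perm σ τ hpr hqt
          (Finset.disjoint_iff_ne.1 (Ps.P_disjoint i j hij) _ hp _ hq)
          (Finset.disjoint_iff_ne.1 (Ps.R_disjoint i j hij) _ hr _ ht)
          (Finset.disjoint_iff_ne.1 (Ps.Q_disjoint i j hij) _ hσp _ hτq)
          (Finset.disjoint_iff_ne.1 (Ps.S_disjoint i j hij) _ hσr _ hτt)
  · exact (inter (hfix i) hσ hτ).trans (hammingDist_ext2Perm_extFix2 σ τ hpr)
  · exact (inter (hswap _) hσ hτ).trans (hammingDist_ext2Perm_swap_mul_extFix2 σ τ hpr)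
  · rw [hammingDist_comm]
    exact (inter (hfix j) hτ hσ).trans (hammingDist_ext2Perm_extFix2 τ σ hqt)
  · have hστ : σ ≠ τ := by rintro rfl; exact hne rfl
    rw [hammingDist_extFix2]
    exact Ps.hd_intra _ σ hσ τ hτ hστ
  · exact (inter (hswap _) hσ hτ).trans (hammingDist_extFix2_swap_mul_extFix2 σ τ)
  · rw [hammingDist_comm]
    exact (inter (hswap _) hτ hσ).trans (hammingDist_ext2Perm_swap_mul_extFix2 τ σ hqt)
  · rw [hammingDist_comm]
    exact (inter (hswap _) hτ hσ).trans (hammingDist_extFix2_swap_mul_extFix2 τ σ)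
  · have hστ : σ ≠ τ := by rintro rfl; exact hne rfl
    rw [hammingDist_mul_left, hammingDist_extFix2]
    exact Ps.hd_intra _ σ hσ τ hτ hστ
end

section
/- Let a, b be nonnegative integers, let A^(1), …, A^(k) be a block decomposition of a set A of permutations of Z_l with hd(A) ≥ l−a, and let B^(1), …, B^(k) be a block decomposition of a set B of permutations of Z_m with hd(B) ≥ m−b. For each i, let M_i = A^(i) ⊗ B^(i). Then hd(⋃_{i=1}^k M_i) ≥ lm − ab, i.e., any two distinct permutations of Z_{lm} in ⋃_{i=1}^k M_i have Hamming distance at least lm − ab. -/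
/-- The modified Kronecker product of permutations: for `α` a permutation of `Z_l` and `β`
a permutation of `Z_m`, `kron α β` is the permutation of `Z_{lm}` with
`(kron α β)(i·m + t) = m·α(i) + β(t)` for all `i ∈ Z_l`, `t ∈ Z_m`
(here `finProdFinEquiv (i, t) = i·m + t`). -/
def kron {l m : ℕ} (α : Equiv.Perm (Fin l)) (β : Equiv.Perm (Fin m)) :
    Equiv.Perm (Fin (l * m)) :=
  (finProdFinEquiv.symm.trans (α.prodCongr β)).trans finProdFinEquiv

/-- The number of agreements of two functions complements their Hamming distance. -/
theorem hammingDist_add_card_filter_eq {ι κ : Type*} [Fintype ι] [DecidableEq κ] (f g : ι → κ) :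
    hammingDist f g + (Finset.univ.filter fun i => f i = g i).card = Fintype.card ι := by
  rw [hammingDist, add_comm]
  exact Finset.card_filter_add_card_filter_not _

/-- Two Kronecker products agree exactly at the pairs of positions where both factors agree. -/
theorem card_filter_kron_eq {l m : ℕ} (α α' : Equiv.Perm (Fin l)) (β β' : Equiv.Perm (Fin m)) :
    (Finset.univ.filter fun x => kron α β x = kron α' β' x).card =
      (Finset.univ.filter fun i => α i = α' i).card *
        (Finset.univ.filter fun t => β t = β' t).card := by
  rw [← Finset.card_product]
  refine Finset.card_equiv finProdFinEquiv.symm fun x => ?_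
  simp only [Finset.mem_product, Finset.mem_filter, Finset.mem_univ, true_and, kron,
    Equiv.trans_apply, EmbeddingLike.apply_eq_iff_eq, Equiv.prodCongr_apply, Prod.map,
    Prod.mk.injEq]

/-- **Lemma.** Let `A⁽¹⁾, …, A⁽ᵏ⁾` be a block decomposition of a set `A` of permutations
of `Z_l` with `hd(A) ≥ l−a`, and `B⁽¹⁾, …, B⁽ᵏ⁾` a block decomposition of a set `B` of
permutations of `Z_m` with `hd(B) ≥ m−b` (within each block, distinct permutations have
Hamming distance exactly `l`, resp. `m`). With `M_i = A⁽ⁱ⁾ ⊗ B⁽ⁱ⁾`, any two distinct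
permutations in `⋃_i M_i` have Hamming distance at least `lm − ab`. -/
theorem kron_hammingDist {l m a b k : ℕ}
    (A : Fin k → Finset (Equiv.Perm (Fin l)))
    (B : Fin k → Finset (Equiv.Perm (Fin m)))
    (hA_disjoint : ∀ i j, i ≠ j → Disjoint (A i) (A j))
    (hA_block : ∀ i, ∀ σ ∈ A i, ∀ τ ∈ A i, σ ≠ τ → hammingDist ⇑σ ⇑τ = l)
    (hA_dist : ∀ i j, ∀ σ ∈ A i, ∀ τ ∈ A j, σ ≠ τ → l - a ≤ hammingDist ⇑σ ⇑τ)
    (hB_disjoint : ∀ i j, i ≠ j → Disjoint (B i) (B j))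
    (hB_block : ∀ i, ∀ σ ∈ B i, ∀ τ ∈ B i, σ ≠ τ → hammingDist ⇑σ ⇑τ = m)
    (hB_dist : ∀ i j, ∀ σ ∈ B i, ∀ τ ∈ B j, σ ≠ τ → m - b ≤ hammingDist ⇑σ ⇑τ) :
    ∀ x ∈ Finset.univ.biUnion fun i => Finset.image₂ kron (A i) (B i),
      ∀ y ∈ Finset.univ.biUnion fun i => Finset.image₂ kron (A i) (B i),
        x ≠ y → l * m - a * b ≤ hammingDist ⇑x ⇑y := by
  intro x hx y hy hxy
  simp only [Finset.mem_biUnion, Finset.mem_univ, true_and, Finset.mem_image₂] at hx hy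
  obtain ⟨i, α, hα, β, hβ, rfl⟩ := hx
  obtain ⟨j, α', hα', β', hβ', rfl⟩ := hy
  have hk := hammingDist_add_card_filter_eq (kron α β) (kron α' β')
  have hl := hammingDist_add_card_filter_eq α α'
  have hm := hammingDist_add_card_filter_eq β β'
  rw [card_filter_kron_eq] at hk
  rw [Fintype.card_fin] at hk hl hm
  set p := (Finset.univ.filter fun i => α i = α' i).card
  set q := (Finset.univ.filter fun t => β t = β' t).card
  suffices h : p * q ≤ a * b by omega
  by_cases hij : i = j
  · subst hij
    by_cases h : α = α'
    · have hne : β ≠ β' := fun h' => hxy (by rw [h, h'])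
      have := hB_block i β hβ β' hβ' hne
      have hq : q = 0 := by omega
      simp [hq]
    · have := hA_block i α hα α' hα' h
      have hp : p = 0 := by omega
      simp [hp]
  · have h₁ := hA_dist i j α hα α' hα' (Finset.disjoint_left.mp (hA_disjoint i j hij) hα <| · ▸ hα')
    have h₂ := hB_dist i j β hβ β' hβ' (Finset.disjoint_left.mp (hB_disjoint i j hij) hβ <| · ▸ hβ')
    exact Nat.mul_le_mul (by omega) (by omega)
end

section
/- Let A^(1), …, A^(k) be a block decomposition of a set A of permutations of Z_l with hd(A) ≥ l−1 in which every block is full (|A^(i)| = l), and let B^(1), …, B^(k) be a block decomposition of a set B of permutations of Z_m with hd(B) ≥ m−1 in which every block is full (|B^(i)| = m). Let n = lm. Then M(n+1, n) ≥ kn, i.e., there exists a set of k·l·m permutations of Z_{lm+1} whose pairwise Hamming distance is at least lm. -/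
/-- `f` and `g` agree in at most one point. -/
def AgreeAtMostOnce {X Y : Type*} (f g : X → Y) : Prop :=
  ∀ x y, f x = g x → f y = g y → x = y

theorem card_agree_add_hammingDist {n : ℕ} {Y : Type*} [DecidableEq Y] (f g : Fin n → Y) :
    (Finset.univ.filter fun x => f x = g x).card + hammingDist f g = n := by
  simpa [hammingDist] using
    Finset.card_filter_add_card_filter_not (s := Finset.univ) (fun x => f x = g x)

theorem agreeAtMostOnce_iff_sub_one_le_hammingDist {n : ℕ} {Y : Type*} [DecidableEq Y]
    (f g : Fin n → Y) : AgreeAtMostOnce f g ↔ n - 1 ≤ hammingDist f g := by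
  have h := card_agree_add_hammingDist f g
  have h1 : AgreeAtMostOnce f g ↔ (Finset.univ.filter fun x => f x = g x).card ≤ 1 := by
    simp only [AgreeAtMostOnce, Finset.card_le_one, Finset.mem_filter, Finset.mem_univ, true_and]
    exact ⟨fun H a ha b hb => H a b ha hb, fun H a b ha hb => H a ha b hb⟩
  rw [h1]
  omega

theorem ne_of_hammingDist_eq {n : ℕ} {Y : Type*} [DecidableEq Y] {f g : Fin n → Y}
    (h : hammingDist f g = n) (x : Fin n) : f x ≠ g x := by
  have h1 := card_agree_add_hammingDist f g
  have h2 : (Finset.univ.filter fun x => f x = g x).card = 0 := by omega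
  rw [Finset.card_eq_zero, Finset.filter_eq_empty_iff] at h2
  exact h2 (Finset.mem_univ x)

/-- A set of permutations of `Fin n` that pairwise agree at most once has at most `n * n`
elements. -/
theorem card_le_mul_self_of_agreeAtMostOnce {n : ℕ} (S : Finset (Equiv.Perm (Fin n)))
    (hS : ∀ σ ∈ S, ∀ τ ∈ S, σ ≠ τ → AgreeAtMostOnce σ τ) (hn : 0 < n) : S.card ≤ n * n := by
  obtain rfl | hn' : n = 1 ∨ 2 ≤ n := by omega
  · exact Finset.card_le_one.2 fun a _ b _ => Subsingleton.elim a b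
  · have h : S.card ≤ (Finset.univ : Finset (Fin n × Fin n)).card := by
      refine Finset.card_le_card_of_injOn (fun σ => (σ ⟨0, hn⟩, σ ⟨1, hn'⟩))
        (fun _ _ => Finset.mem_coe.2 (Finset.mem_univ _)) ?_
      intro σ hσ τ hτ h
      by_contra hne
      have := hS σ hσ τ hτ hne _ _ (Prod.ext_iff.1 h).1 (Prod.ext_iff.1 h).2
      simp at this
    simpa using h

/-- Disjoint full blocks of permutations of `Fin n` at distance at least `n - 1`: there are at
most `n` of them. -/
theorem card_blocks_le {n k : ℕ} (hn : 0 < n) (A : Fin k → Finset (Equiv.Perm (Fin n)))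
    (hdisj : ∀ i j, i ≠ j → Disjoint (A i) (A j)) (hfull : ∀ i, (A i).card = n)
    (hdist : ∀ i j, ∀ σ ∈ A i, ∀ τ ∈ A j, σ ≠ τ → n - 1 ≤ hammingDist ⇑σ ⇑τ) : k ≤ n := by
  have h := card_le_mul_self_of_agreeAtMostOnce (Finset.univ.biUnion A) (by
    intro σ hσ τ hτ hne
    obtain ⟨i, -, hi⟩ := Finset.mem_biUnion.1 hσ
    obtain ⟨j, -, hj⟩ := Finset.mem_biUnion.1 hτ
    exact (agreeAtMostOnce_iff_sub_one_le_hammingDist _ _).2 (hdist i j σ hi τ hj hne)) hn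
  rw [Finset.card_biUnion fun i _ j _ hij => hdisj i j hij] at h
  simp only [hfull, Finset.sum_const, Finset.card_univ, Fintype.card_fin, smul_eq_mul] at h
  exact Nat.le_of_mul_le_mul_right h hn

/-- Extend `σ` by a new point `none`: the position `p` receives the new symbol, and the symbol
`σ p` moves to the new position. -/
def extendAt {X : Type*} [DecidableEq X] (σ : Equiv.Perm X) (p : X) : Equiv.Perm (Option X) :=
  (Equiv.swap none (some p)).trans (Equiv.optionCongr σ)

section extendAt

variable {X : Type*} [DecidableEq X]

theorem extendAt_none (σ : Equiv.Perm X) (p : X) : extendAt σ p none = some (σ p) := by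
  simp [extendAt]

theorem extendAt_some (σ : Equiv.Perm X) (p x : X) :
    extendAt σ p (some x) = if x = p then none else some (σ x) := by
  by_cases h : x = p
  · simp [extendAt, h]
  · simp [extendAt, h, Equiv.swap_apply_of_ne_of_ne]

theorem agreeAtMostOnce_extendAt_of_forall_ne {σ τ : Equiv.Perm X} (h : ∀ x, σ x ≠ τ x)
    (p q : X) : AgreeAtMostOnce (extendAt σ p) (extendAt τ q) := by
  rintro (_ | x) (_ | y) hx hy <;> simp only [extendAt_none, extendAt_some] at hx hy <;>
    grind

theorem agreeAtMostOnce_extendAt_of_ne {σ τ : Equiv.Perm X} {p q : X}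
    (h : AgreeAtMostOnce σ τ) (hpq : p ≠ q) (hne : σ p ≠ τ q) :
    AgreeAtMostOnce (extendAt σ p) (extendAt τ q) := by
  have key : ∀ z, extendAt σ p z = extendAt τ q z → ∃ x, z = some x ∧ σ x = τ x := by
    rintro (_ | x) hz <;> simp only [extendAt_none, extendAt_some] at hz <;> grind
  intro x y hx hy
  obtain ⟨a, rfl, ha⟩ := key x hx
  obtain ⟨b, rfl, hb⟩ := key y hy
  rw [h a b ha hb]

end extendAt

theorem agreeAtMostOnce_prodCongr {X Y : Type*} {α α' : Equiv.Perm X} {β β' : Equiv.Perm Y}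
    (hα : AgreeAtMostOnce α α') (hβ : AgreeAtMostOnce β β') :
    AgreeAtMostOnce (α.prodCongr β) (α'.prodCongr β') := by
  rintro ⟨a, b⟩ ⟨c, d⟩ h1 h2
  simp only [Equiv.prodCongr_apply, Prod.map_apply, Prod.mk.injEq] at h1 h2
  rw [hα a c h1.1 h2.1, hβ b d h1.2 h2.2]

/-- **Lemma.** Let `A⁽¹⁾, …, A⁽ᵏ⁾` be a block decomposition of a set `A` of permutations
of `Z_l` with `hd(A) ≥ l−1` in which every block is full (`|A⁽ⁱ⁾| = l`), and let
`B⁽¹⁾, …, B⁽ᵏ⁾` be a block decomposition of a set `B` of permutations of `Z_m` with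
`hd(B) ≥ m−1` in which every block is full (`|B⁽ⁱ⁾| = m`). Then, with `n = lm`,
`M(n+1, n) ≥ kn`: there is a set of `k·l·m` permutations of `Z_{lm+1}` with pairwise
Hamming distance at least `lm`. -/
theorem kron_full_blocks {l m k : ℕ}
    (A : Fin k → Finset (Equiv.Perm (Fin l)))
    (B : Fin k → Finset (Equiv.Perm (Fin m)))
    (hA_disjoint : ∀ i j, i ≠ j → Disjoint (A i) (A j))
    (hA_block : ∀ i, ∀ σ ∈ A i, ∀ τ ∈ A i, σ ≠ τ → hammingDist ⇑σ ⇑τ = l)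
    (hA_full : ∀ i, (A i).card = l)
    (hA_dist : ∀ i j, ∀ σ ∈ A i, ∀ τ ∈ A j, σ ≠ τ → l - 1 ≤ hammingDist ⇑σ ⇑τ)
    (hB_disjoint : ∀ i j, i ≠ j → Disjoint (B i) (B j))
    (hB_block : ∀ i, ∀ σ ∈ B i, ∀ τ ∈ B i, σ ≠ τ → hammingDist ⇑σ ⇑τ = m)
    (hB_full : ∀ i, (B i).card = m)
    (hB_dist : ∀ i j, ∀ σ ∈ B i, ∀ τ ∈ B j, σ ≠ τ → m - 1 ≤ hammingDist ⇑σ ⇑τ) :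
    ∃ S : Finset (Equiv.Perm (Fin (l * m + 1))), S.card = k * (l * m) ∧
      ∀ σ ∈ S, ∀ τ ∈ S, σ ≠ τ → l * m ≤ hammingDist ⇑σ ⇑τ := by
  classical
  obtain h0 | hpos := Nat.eq_zero_or_pos (l * m)
  · exact ⟨∅, by simp [h0], by simp⟩
  have hl : 0 < l := Nat.pos_of_mul_pos_right hpos
  have hm : 0 < m := Nat.pos_of_mul_pos_left hpos
  have hkl := card_blocks_le hl A hA_disjoint hA_full hA_dist
  have hkm := card_blocks_le hm B hB_disjoint hB_full hB_dist
  let e : Fin (l * m + 1) ≃ Option (Fin l × Fin m) :=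
    (finSuccEquiv (l * m)).trans (Equiv.optionCongr finProdFinEquiv.symm)
  -- In block `c`, the new symbol goes to the position `(c, t)` holding a symbol `(_, c)`.
  let E : (Σ _ : Fin k, Equiv.Perm (Fin l) × Equiv.Perm (Fin m)) →
      Equiv.Perm (Option (Fin l × Fin m)) := fun s =>
    extendAt (s.2.1.prodCongr s.2.2) (s.1.castLE hkl, s.2.2.symm (s.1.castLE hkm))
  let F : (Σ _ : Fin k, Equiv.Perm (Fin l) × Equiv.Perm (Fin m)) →
      Equiv.Perm (Fin (l * m + 1)) := fun s => (e.trans (E s)).trans e.symm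
  let I : Finset (Σ _ : Fin k, Equiv.Perm (Fin l) × Equiv.Perm (Fin m)) :=
    Finset.univ.sigma fun c => A c ×ˢ B c
  have hE : ∀ s ∈ I, ∀ t ∈ I, s ≠ t → AgreeAtMostOnce (E s) (E t) := by
    rintro ⟨c, α, β⟩ hs ⟨d, α', β'⟩ ht hne
    simp only [I, Finset.mem_sigma, Finset.mem_univ, true_and, Finset.mem_product] at hs ht
    by_cases hcd : c = d
    · subst hcd
      refine agreeAtMostOnce_extendAt_of_forall_ne ?_ _ _
      rintro ⟨x, y⟩ h
      simp only [Equiv.prodCongr_apply, Prod.map_apply, Prod.mk.injEq] at h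
      by_cases hα : α = α'
      · have hβ : β ≠ β' := by
          rintro rfl
          exact hne (by rw [hα])
        exact ne_of_hammingDist_eq (hB_block c β hs.2 β' ht.2 hβ) y h.2
      · exact ne_of_hammingDist_eq (hA_block c α hs.1 α' ht.1 hα) x h.1
    · refine agreeAtMostOnce_extendAt_of_ne (agreeAtMostOnce_prodCongr ?_ ?_) ?_ ?_
      · exact (agreeAtMostOnce_iff_sub_one_le_hammingDist _ _).2 (hA_dist c d α hs.1 α' ht.1
          (Finset.disjoint_iff_ne.1 (hA_disjoint c d hcd) α hs.1 α' ht.1))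
      · exact (agreeAtMostOnce_iff_sub_one_le_hammingDist _ _).2 (hB_dist c d β hs.2 β' ht.2
          (Finset.disjoint_iff_ne.1 (hB_disjoint c d hcd) β hs.2 β' ht.2))
      · simp [hcd]
      · simp [hcd]
  have hF : ∀ s ∈ I, ∀ t ∈ I, s ≠ t → l * m ≤ hammingDist ⇑(F s) ⇑(F t) := by
    intro s hs t ht hne
    have h := (agreeAtMostOnce_iff_sub_one_le_hammingDist (F s) (F t)).1 (by
      intro x y hx hy
      exact e.injective (hE s hs t ht hne _ _ (e.symm.injective hx) (e.symm.injective hy)))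
    simpa using h
  refine ⟨I.image F, ?_, ?_⟩
  · rw [Finset.card_image_of_injOn]
    · simp [I, Finset.card_sigma, Finset.card_product, hA_full, hB_full]
    · intro s hs t ht hst
      by_contra hne
      have h := hF s hs t ht hne
      rw [hst, hammingDist_self] at h
      omega
  · intro σ hσ τ hτ hne
    obtain ⟨s, hs, rfl⟩ := Finset.mem_image.1 hσ
    obtain ⟨t, ht, rfl⟩ := Finset.mem_image.1 hτ
    exact hF s hs t ht fun h => hne (by rw [h])
end

section
/- Let p and q be prime powers, let n = pq, and let k = min{p−1, q−1}. Then M(n+1, n) ≥ kn, i.e., there exists a set of min{p−1, q−1}·pq permutations of Z_{pq+1} whose pairwise Hamming distance is at least pq. -/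
section AffineExtension

variable {K L : Type*} [Field K] [Field L]

lemma eq_of_affine_eq {a a' b b' x x' : K} (ha : a ≠ a') (h : a * x + b = a' * x + b')
    (h' : a * x' + b = a' * x' + b') : x = x' := by
  have : (a - a') * (x - x') = 0 := by linear_combination h - h'
  exact sub_eq_zero.1 ((mul_eq_zero.1 this).resolve_left (sub_ne_zero.2 ha))

/-- The affine permutation `(x, y) ↦ (a x + b, c y + d)` of `K × L`. -/
def affineProdPerm (a : Kˣ) (c : Lˣ) (b : K) (d : L) : Equiv.Perm (K × L) :=
  Equiv.prodCongr (a.mulLeft.trans (Equiv.addRight b)) (c.mulLeft.trans (Equiv.addRight d))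

/-- The extension of `affineProdPerm a c b d` by a new point, inserted at the unique position
in `{a} × L` which is mapped to `K × {c}`. -/
def extendedAffinePerm [DecidableEq K] [DecidableEq L] (a : Kˣ) (c : Lˣ) (b : K) (d : L) :
    Equiv.Perm (Option (K × L)) :=
  (Equiv.swap none (some ((a : K), (c⁻¹ : Lˣ) * ((c : L) - d)))).trans
    (Equiv.optionCongr (affineProdPerm a c b d))

variable [DecidableEq K] [DecidableEq L]

lemma extendedAffinePerm_none (a : Kˣ) (c : Lˣ) (b : K) (d : L) :
    extendedAffinePerm a c b d none = some (a * a + b, (c : L)) := by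
  simp [extendedAffinePerm, affineProdPerm]

lemma extendedAffinePerm_some (a : Kˣ) (c : Lˣ) (b : K) (d : L) (x : K) (y : L) :
    extendedAffinePerm a c b d (some (x, y)) =
      if x = a ∧ c * y + d = c then none else some (a * x + b, c * y + d) := by
  have h : y = (c⁻¹ : Lˣ) * ((c : L) - d) ↔ c * y + d = c := by
    rw [Units.eq_inv_mul_iff_mul_eq, eq_sub_iff_add_eq]
  by_cases hxy : x = a ∧ c * y + d = c
  · have hy := h.2 hxy.2
    rw [if_pos hxy, hxy.1, hy]
    simp [extendedAffinePerm]
  · rw [if_neg hxy, extendedAffinePerm, Equiv.trans_apply, Equiv.swap_apply_of_ne_of_ne]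
    · simp [affineProdPerm]
    · simp
    · rintro ⟨⟩
      exact hxy ⟨rfl, h.1 rfl⟩

lemma extendedAffinePerm_agree_same {a : Kˣ} {c : Lˣ} {b b' : K} {d d' : L}
    (hne : (b, d) ≠ (b', d')) {z w : Option (K × L)}
    (hz : extendedAffinePerm a c b d z = extendedAffinePerm a c b' d' z)
    (hw : extendedAffinePerm a c b d w = extendedAffinePerm a c b' d' w) : z = w := by
  have key : ∀ x y, extendedAffinePerm a c b d (some (x, y)) =
      extendedAffinePerm a c b' d' (some (x, y)) → x = a ∧ c * y + d = c ∧ d = d' := by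
    intro x y h
    rw [extendedAffinePerm_some, extendedAffinePerm_some] at h
    split_ifs at h with h₁ h₂
    · exact ⟨h₁.1, h₁.2, add_left_cancel (h₁.2.trans h₂.2.symm)⟩
    · simp only [Option.some.injEq, Prod.mk.injEq, add_right_inj] at h
      exact absurd (Prod.ext h.1 h.2) hne
  have key' : extendedAffinePerm a c b d none = extendedAffinePerm a c b' d' none → b = b' := by
    simp [extendedAffinePerm_none]
  rcases z with - | ⟨x, y⟩ <;> rcases w with - | ⟨x', y'⟩
  · rfl
  · exact absurd (Prod.ext (key' hz) (key _ _ hw).2.2) hne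
  · exact absurd (Prod.ext (key' hw) (key _ _ hz).2.2) hne
  · obtain ⟨hx, hy, -⟩ := key _ _ hz
    obtain ⟨hx', hy', -⟩ := key _ _ hw
    have : y = y' := mul_left_cancel₀ c.ne_zero (add_right_cancel (hy.trans hy'.symm))
    rw [hx, hx', this]

lemma extendedAffinePerm_agree_of_ne {a a' : Kˣ} {c c' : Lˣ} {b b' : K} {d d' : L}
    (ha : a ≠ a') (hc : c ≠ c') {z w : Option (K × L)}
    (hz : extendedAffinePerm a c b d z = extendedAffinePerm a' c' b' d' z)
    (hw : extendedAffinePerm a c b d w = extendedAffinePerm a' c' b' d' w) : z = w := by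
  have ha' : (a : K) ≠ a' := Units.val_injective.ne ha
  have hc' : (c : L) ≠ c' := Units.val_injective.ne hc
  have key : ∀ x y, extendedAffinePerm a c b d (some (x, y)) =
      extendedAffinePerm a' c' b' d' (some (x, y)) →
        a * x + b = a' * x + b' ∧ c * y + d = c' * y + d' := by
    intro x y h
    rw [extendedAffinePerm_some, extendedAffinePerm_some] at h
    split_ifs at h with h₁ h₂
    · exact absurd (h₁.1.symm.trans h₂.1) ha'
    · simpa using h
  rcases z with - | ⟨x, y⟩
  · simp [extendedAffinePerm_none, hc'] at hz
  rcases w with - | ⟨x', y'⟩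
  · simp [extendedAffinePerm_none, hc'] at hw
  rw [eq_of_affine_eq ha' (key _ _ hz).1 (key _ _ hw).1,
    eq_of_affine_eq hc' (key _ _ hz).2 (key _ _ hw).2]

end AffineExtension

/-- Functions agreeing in at most one point have Hamming distance at least one less than the
number of points. -/
lemma le_hammingDist_of_agree {ι β : Type*} [Fintype ι] [DecidableEq β] {f g : ι → β} {n : ℕ}
    (hn : Fintype.card ι = n + 1) (h : ∀ z w, f z = g z → f w = g w → z = w) :
    n ≤ hammingDist f g := by
  have h₁ : (Finset.univ.filter fun i => f i = g i).card ≤ 1 :=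
    Finset.card_le_one.2 fun z hz w hw => h z w (by simpa using hz) (by simpa using hw)
  have h₂ := Finset.card_filter_add_card_filter_not (s := Finset.univ) fun i => f i = g i
  rw [Finset.card_univ, hn] at h₂
  change n ≤ (Finset.univ.filter fun i => ¬ f i = g i).card
  omega

/-- A family of permutations any two of which agree in at most one point yields a permutation
array of the same size. -/
lemma exists_permutationArray {ι X : Type*} [Fintype ι] [Fintype X] {n : ℕ} (hn : 0 < n)
    (hX : Fintype.card X = n + 1) (f : ι → Equiv.Perm X)
    (hf : ∀ s t, s ≠ t → ∀ z w, f s z = f t z → f s w = f t w → z = w) :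
    ∃ S : Finset (Equiv.Perm (Fin (n + 1))), S.card = Fintype.card ι ∧
      ∀ σ ∈ S, ∀ τ ∈ S, σ ≠ τ → n ≤ hammingDist ⇑σ ⇑τ := by
  classical
  let e : X ≃ Fin (n + 1) := Fintype.equivFinOfCardEq hX
  have : Nontrivial X := Fintype.one_lt_card_iff_nontrivial.1 (by omega)
  obtain ⟨z, w, hzw⟩ := exists_pair_ne X
  have hinj : Function.Injective f := fun s t hst => by
    by_contra hne
    exact hzw (hf s t hne z w (by rw [hst]) (by rw [hst]))
  refine ⟨Finset.univ.image fun s => e.permCongr (f s), ?_, ?_⟩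
  · exact Finset.card_image_of_injective _ (e.permCongr.injective.comp hinj)
  · simp only [Finset.mem_image, Finset.mem_univ, true_and]
    rintro _ ⟨s, rfl⟩ _ ⟨t, rfl⟩ hne
    refine le_hammingDist_of_agree (Fintype.card_fin _) fun z w hz hw => ?_
    have hst : s ≠ t := fun h => hne (by rw [h])
    simp only [Equiv.permCongr_apply, EmbeddingLike.apply_eq_iff_eq] at hz hw
    exact e.symm.injective (hf s t hst _ _ hz hw)

lemma exists_permutationArray_of_field (K L : Type*) [Field K] [Field L] [Fintype K] [Fintype L] :
    ∃ S : Finset (Equiv.Perm (Fin (Fintype.card K * Fintype.card L + 1))),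
      S.card = min (Fintype.card K - 1) (Fintype.card L - 1) *
        (Fintype.card K * Fintype.card L) ∧
      ∀ σ ∈ S, ∀ τ ∈ S, σ ≠ τ →
        Fintype.card K * Fintype.card L ≤ hammingDist ⇑σ ⇑τ := by
  classical
  let k := min (Fintype.card K - 1) (Fintype.card L - 1)
  obtain ⟨u⟩ : Nonempty (Fin k ↪ Kˣ) := Function.Embedding.nonempty_of_card_le (by
    rw [Fintype.card_fin, Fintype.card_units]; exact min_le_left _ _)
  obtain ⟨v⟩ : Nonempty (Fin k ↪ Lˣ) := Function.Embedding.nonempty_of_card_le (by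
    rw [Fintype.card_fin, Fintype.card_units]; exact min_le_right _ _)
  obtain ⟨S, hS, hd⟩ := exists_permutationArray (ι := Fin k × K × L) (X := Option (K × L))
    (n := Fintype.card K * Fintype.card L) (Nat.mul_pos Fintype.card_pos Fintype.card_pos)
    (by simp) (fun s => extendedAffinePerm (u s.1) (v s.1) s.2.1 s.2.2) (by
      rintro ⟨i, b, d⟩ ⟨j, b', d'⟩ hne z w hz hw
      by_cases hij : i = j
      · subst hij
        exact extendedAffinePerm_agree_same (fun h => hne (by rw [h])) hz hw
      · exact extendedAffinePerm_agree_of_ne (u.injective.ne hij) (v.injective.ne hij) hz hw)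
  exact ⟨S, by simpa using hS, hd⟩


/-- **Corollary.** Let `p` and `q` be prime powers, `n = pq`, and
`k = min{p−1, q−1}`. Then `M(n+1, n) ≥ kn`: there exists a set of
`min{p−1, q−1}·pq` permutations of `Z_{pq+1}` whose pairwise Hamming distance is at
least `pq`. -/
theorem M_primePow_product {p q : ℕ} (hp : IsPrimePow p) (hq : IsPrimePow q) :
    ∃ S : Finset (Equiv.Perm (Fin (p * q + 1))),
      S.card = min (p - 1) (q - 1) * (p * q) ∧
      ∀ σ ∈ S, ∀ τ ∈ S, σ ≠ τ → p * q ≤ hammingDist ⇑σ ⇑τ := by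
  obtain ⟨i⟩ := (Fintype.nonempty_field_iff (α := Fin p)).2 (by simpa using hp)
  obtain ⟨j⟩ := (Fintype.nonempty_field_iff (α := Fin q)).2 (by simpa using hq)
  have h := @exists_permutationArray_of_field (Fin p) (Fin q) i j _ _
  rwa [Fintype.card_fin, Fintype.card_fin] at h
end

section
/- If n ≥ 2 and there exist k mutually orthogonal Latin squares L_1, …, L_k of order n, then there exist pairwise disjoint sets D_1, …, D_k of permutations of Z_n such that |D_s| = n for each s, any two distinct permutations within the same D_s have Hamming distance exactly n (they disagree in every position), and any two permutations σ ∈ D_s, τ ∈ D_t with s ≠ t have Hamming distance at least n−1. In particular, M(n, n−1) ≥ kn. -/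
/-- A Latin square of order `n`: every row and every column is a bijection of `Z_n`. -/
def IsLatinSquare {n : ℕ} (L : Fin n → Fin n → Fin n) : Prop :=
  (∀ i, Function.Bijective fun j => L i j) ∧ (∀ j, Function.Bijective fun i => L i j)

/-- Two Latin squares of order `n` are orthogonal if the map
`(i,j) ↦ (L(i,j), L'(i,j))` is injective. -/
def IsOrthogonal {n : ℕ} (L L' : Fin n → Fin n → Fin n) : Prop :=
  Function.Injective fun p : Fin n × Fin n => (L p.1 p.2, L' p.1 p.2)

/-- The cells of a Latin square holding the symbol `a` form the graph of a permutation. -/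
theorem IsLatinSquare.exists_symbol_perm {n : ℕ} {L : Fin n → Fin n → Fin n}
    (hL : IsLatinSquare L) (a : Fin n) : ∃ σ : Equiv.Perm (Fin n), ∀ i, L i (σ i) = a := by
  choose f hf using fun i => (hL.1 i).surjective a
  have hinj : Function.Injective f := fun i i' h =>
    (hL.2 (f i)).injective ((hf i).trans ((hf i').symm.trans (by rw [h])))
  exact ⟨Equiv.ofBijective f (Finite.injective_iff_bijective.mp hinj), hf⟩

/-- Functions that never agree are at maximal Hamming distance. -/
theorem hammingDist_eq_card_of_forall_ne {ι β : Type*} [Fintype ι] [DecidableEq β]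
    {f g : ι → β} (h : ∀ i, f i ≠ g i) : hammingDist f g = Fintype.card ι := by
  simp [hammingDist, h]

/-- Functions that agree in at most one position are at Hamming distance at least one less
than the maximum. -/
theorem card_sub_one_le_hammingDist {ι β : Type*} [Fintype ι] [DecidableEq β]
    {f g : ι → β} (h : ∀ i j, f i = g i → f j = g j → i = j) :
    Fintype.card ι - 1 ≤ hammingDist f g := by
  have hle : (Finset.univ.filter fun i => f i = g i).card ≤ 1 :=
    Finset.card_le_one.mpr fun i hi j hj =>
      h i j (Finset.mem_filter.mp hi).2 (Finset.mem_filter.mp hj).2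
  have hadd := Finset.card_filter_add_card_filter_not (s := Finset.univ) fun i => f i = g i
  rw [Finset.card_univ] at hadd
  unfold hammingDist
  simp only [ne_eq]
  omega

/-- **Proposition.** If `n ≥ 2` and there exist `k` mutually orthogonal Latin squares of
order `n`, then there exist pairwise disjoint sets `D_1, …, D_k` of permutations of `Z_n`,
each of size `n`, such that distinct permutations within the same `D_s` have Hamming
distance exactly `n`, and permutations from different sets have Hamming distance at least
`n−1`. In particular, `M(n, n−1) ≥ kn`. -/
theorem MOLS_to_permutation_array {n k : ℕ} (hn : 2 ≤ n)
    (L : Fin k → Fin n → Fin n → Fin n)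
    (hL : ∀ s, IsLatinSquare (L s))
    (hL_ne : ∀ s t, s ≠ t → L s ≠ L t)
    (hL_orth : ∀ s t, s ≠ t → IsOrthogonal (L s) (L t)) :
    (∃ D : Fin k → Finset (Equiv.Perm (Fin n)),
      (∀ s t, s ≠ t → Disjoint (D s) (D t)) ∧
      (∀ s, (D s).card = n) ∧
      (∀ s, ∀ σ ∈ D s, ∀ τ ∈ D s, σ ≠ τ → hammingDist ⇑σ ⇑τ = n) ∧
      (∀ s t, s ≠ t → ∀ σ ∈ D s, ∀ τ ∈ D t, n - 1 ≤ hammingDist ⇑σ ⇑τ)) ∧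
    (∃ S : Finset (Equiv.Perm (Fin n)), S.card = k * n ∧
      ∀ σ ∈ S, ∀ τ ∈ S, σ ≠ τ → n - 1 ≤ hammingDist ⇑σ ⇑τ) := by
  choose P hP using fun s a => (hL s).exists_symbol_perm a
  have hsame (s : Fin k) {a b : Fin n} (hab : a ≠ b) : hammingDist ⇑(P s a) ⇑(P s b) = n := by
    simpa using hammingDist_eq_card_of_forall_ne fun i h =>
      hab ((hP s a i).symm.trans (by rw [h, hP s b i]))
  have hdiff {s t : Fin k} (hst : s ≠ t) (a b : Fin n) :
      n - 1 ≤ hammingDist ⇑(P s a) ⇑(P t b) := by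
    have hle : Fintype.card (Fin n) - 1 ≤ hammingDist ⇑(P s a) ⇑(P t b) := by
      refine card_sub_one_le_hammingDist fun i j hi hj => ?_
      have hpair : (i, P s a i) = (j, P s a j) := hL_orth s t hst <| by
        simp only [Prod.mk.injEq]
        exact ⟨by rw [hP, hP], by rw [hi, hj, hP, hP]⟩
      exact congrArg Prod.fst hpair
    simpa using hle
  have hinj : Function.Injective fun p : Fin k × Fin n => P p.1 p.2 := by
    rintro ⟨s, a⟩ ⟨t, b⟩ (h : P s a = P t b)
    obtain rfl : s = t := by
      by_contra hst
      have := hdiff hst a b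
      rw [h, hammingDist_self] at this
      omega
    obtain rfl : a = b := by
      by_contra hab
      have := hsame s hab
      rw [h, hammingDist_self] at this
      omega
    rfl
  refine ⟨⟨fun s => Finset.univ.image (P s), ?_, ?_, ?_, ?_⟩,
    Finset.univ.image fun p : Fin k × Fin n => P p.1 p.2, ?_, ?_⟩
  · intro s t hst
    simp only [Finset.disjoint_left, Finset.mem_image, Finset.mem_univ, true_and]
    rintro _ ⟨a, rfl⟩ ⟨b, h⟩
    exact hst (congrArg Prod.fst (@hinj (t, b) (s, a) h)).symm
  · intro s
    have hs : Function.Injective (P s) := fun a b h =>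
      congrArg Prod.snd (@hinj (s, a) (s, b) h)
    simp [Finset.card_image_of_injective _ hs]
  · simp only [Finset.mem_image, Finset.mem_univ, true_and]
    rintro s _ ⟨a, rfl⟩ _ ⟨b, rfl⟩ hne
    exact hsame s fun h => hne (by rw [h])
  · simp only [Finset.mem_image, Finset.mem_univ, true_and]
    rintro s t hst _ ⟨a, rfl⟩ _ ⟨b, rfl⟩
    exact hdiff hst a b
  · simp [Finset.card_image_of_injective _ hinj]
  · simp only [Finset.mem_image, Finset.mem_univ, true_and]
    rintro _ ⟨⟨s, a⟩, rfl⟩ _ ⟨⟨t, b⟩, rfl⟩ hne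
    by_cases hst : s = t
    · subst hst
      exact (Nat.sub_le n 1).trans (hsame s fun h => hne (by rw [h])).ge
    · exact hdiff hst a b
end

section
/- M(39, 37) ≥ 1301: there exists a set of 1301 permutations of Z_39 whose pairwise Hamming distance is at least 37. -/
section UnipotentCode

variable {F : Type*} [Field F] [DecidableEq F]

/-- The translation `1 / (x - a) ↦ 1 / (x - a) + 1 / t` of the projective line `Option F`, which
fixes only `a`, modified on `Option (Option F)` so that `a` and the new point `none` are swapped. -/
def unipotentFun (a t : F) : Option (Option F) → Option (Option F)
  | none => some (some a)
  | some none => some (some (a + t))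
  | some (some x) =>
    if x = a then none
    else if x = a - t then some none
    else some (some (((a + t) * x - a ^ 2) / (x + t - a)))

theorem unipotentFun_neg_apply (a t : F) (ht : t ≠ 0) (i : Option (Option F)) :
    unipotentFun a (-t) (unipotentFun a t i) = i := by
  rcases i with _ | _ | x
  · simp [unipotentFun]
  · simp [unipotentFun, ht]
  · by_cases hxa : x = a
    · simp [unipotentFun, hxa]
    by_cases hxt : x = a - t
    · simp [unipotentFun, hxt, ht, sub_eq_add_neg]
    have hd : x + t - a ≠ 0 := fun h => hxt (by linear_combination h)
    have h1 : ((a + t) * x - a ^ 2) / (x + t - a) ≠ a := by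
      rw [Ne, div_eq_iff hd]
      intro h
      have : t * (x - a) = 0 := by linear_combination h
      simp [ht, sub_eq_zero, hxa] at this
    have h2 : ((a + t) * x - a ^ 2) / (x + t - a) ≠ a - -t := by
      rw [Ne, div_eq_iff hd]
      intro h
      have : t * t = 0 := by linear_combination -h
      simp [ht] at this
    have h3 : ((a + t) * x - a ^ 2) / (x + t - a) + -t - a ≠ 0 :=
      fun h => h2 (by linear_combination h)
    simp only [unipotentFun, hxa, hxt, h1, h2, if_false]
    congr 2
    rw [div_eq_iff h3]
    field_simp
    ring

/-- `unipotentFun a t` as a permutation. -/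
def unipotentPerm (a : F) (t : Fˣ) : Equiv.Perm (Option (Option F)) where
  toFun := unipotentFun a t
  invFun := unipotentFun a (-t)
  left_inv := unipotentFun_neg_apply a t t.ne_zero
  right_inv i := by
    simpa using unipotentFun_neg_apply a (-t : F) (neg_ne_zero.mpr t.ne_zero) i

theorem unipotentFun_agree {a b s t x : F}
    (h : unipotentFun a s (some (some x)) = unipotentFun b t (some (some x))) :
    (x = a ∧ x = b) ∨ (x ≠ a ∧ x ≠ b ∧
      ((a + s) * x - a ^ 2) * (x + t - b) = ((b + t) * x - b ^ 2) * (x + s - a)) := by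
  by_cases ha : x = a <;> by_cases hb : x = b
  · exact Or.inl ⟨ha, hb⟩
  · rw [unipotentFun, unipotentFun, if_pos ha, if_neg hb] at h
    split_ifs at h
  · rw [unipotentFun, unipotentFun, if_neg ha, if_pos hb] at h
    split_ifs at h
  · refine Or.inr ⟨ha, hb, ?_⟩
    simp only [unipotentFun, ha, hb, if_false] at h
    by_cases hs : x = a - s <;> by_cases ht : x = b - t
    · have e1 : x + s - a = 0 := by linear_combination hs
      have e2 : x + t - b = 0 := by linear_combination ht
      rw [e1, e2, mul_zero, mul_zero]
    · rw [if_pos hs, if_neg ht] at h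
      simp at h
    · rw [if_neg hs, if_pos ht] at h
      simp at h
    · have e1 : x + s - a ≠ 0 := fun h => hs (by linear_combination h)
      have e2 : x + t - b ≠ 0 := fun h => ht (by linear_combination h)
      rwa [if_neg hs, if_neg ht, Option.some.injEq, Option.some.injEq,
        div_eq_div_iff e1 e2] at h

theorem unipotentFun_no_three_agree {a b s t : F} (hne : ¬(a = b ∧ s = t))
    {i j k : Option (Option F)} (hij : i ≠ j) (hik : i ≠ k) (hjk : j ≠ k)
    (hi : unipotentFun a s i = unipotentFun b t i)
    (hj : unipotentFun a s j = unipotentFun b t j)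
    (hk : unipotentFun a s k = unipotentFun b t k) : False := by
  by_cases hab : a = b
  · subst hab
    have hst : s - t ≠ 0 := fun h => hne ⟨rfl, by linear_combination h⟩
    have key : ∀ l, unipotentFun a s l = unipotentFun a t l → l = none ∨ l = some (some a) := by
      rintro (_ | _ | x) h
      · simp
      · simp only [unipotentFun, Option.some.injEq, add_right_inj] at h
        exact absurd (sub_eq_zero.mpr h) hst
      · rcases unipotentFun_agree h with h | ⟨h1, -, h⟩
        · simp [h.1]
        · have : (s - t) * (x - a) ^ 2 = 0 := by linear_combination h
          simp [hst, sub_eq_zero, h1] at this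
    grind
  · have quad : ∀ x, unipotentFun a s (some (some x)) = unipotentFun b t (some (some x)) →
        ((a + s) * x - a ^ 2) * (x + t - b) = ((b + t) * x - b ^ 2) * (x + s - a) := by
      intro x h
      rcases unipotentFun_agree h with h | h
      · exact absurd (h.1.symm.trans h.2) hab
      · exact h.2.2
    have hnone : ∀ l, unipotentFun a s l = unipotentFun b t l → l ≠ none := by
      rintro l h rfl
      simp [unipotentFun, hab] at h
    have two : ∀ x y, x ≠ y → a + s = b + t →
        unipotentFun a s (some (some x)) = unipotentFun b t (some (some x)) →
        unipotentFun a s (some (some y)) = unipotentFun b t (some (some y)) → False := by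
      intro x y hxy hinf hx hy
      have hx := quad x hx
      have hy := quad y hy
      have hab' := sub_ne_zero.mpr hab
      obtain rfl : t = a + s - b := by linear_combination -hinf
      have e : (x - y) * ((a - b) * (2 * s + a - b)) = 0 := by linear_combination hx - hy
      simp only [mul_eq_zero, sub_ne_zero.mpr hxy, hab', false_or] at e
      have : (a - b) ^ 3 = 0 := by grind
      simp [hab'] at this
    have three : ∀ x y z, x ≠ y → x ≠ z → y ≠ z →
        unipotentFun a s (some (some x)) = unipotentFun b t (some (some x)) →
        unipotentFun a s (some (some y)) = unipotentFun b t (some (some y)) →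
        unipotentFun a s (some (some z)) = unipotentFun b t (some (some z)) → False := by
      intro x y z hxy hxz hyz hx hy hz
      refine two x y hxy ?_ hx hy
      have hx := quad x hx
      have hy := quad y hy
      have hz := quad z hz
      have e : (x - y) * ((x - z) * ((y - z) * (a + s - (b + t)))) = 0 := by
        linear_combination (y - z) * hx - (x - z) * hy + (x - y) * hz
      simpa [sub_ne_zero.mpr hxy, sub_ne_zero.mpr hxz, sub_ne_zero.mpr hyz, sub_eq_zero] using e
    have inf : unipotentFun a s (some none) = unipotentFun b t (some none) → a + s = b + t := by
      simp [unipotentFun]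
    rcases i with _ | _ | x <;> rcases j with _ | _ | y <;> rcases k with _ | _ | z <;>
      simp only [ne_eq, Option.some.injEq, not_true_eq_false] at hij hik hjk <;> grind

theorem card_le_hammingDist_unipotentPerm [Fintype F] {p q : F × Fˣ} (hpq : p ≠ q) :
    Fintype.card F ≤ hammingDist (unipotentPerm p.1 p.2) (unipotentPerm q.1 q.2) := by
  have hle : (Finset.univ.filter fun i =>
      unipotentPerm p.1 p.2 i = unipotentPerm q.1 q.2 i).card ≤ 2 := by
    by_contra! h
    obtain ⟨i, j, k, hi, hj, hk, hij, hik, hjk⟩ := Finset.two_lt_card_iff.mp h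
    simp only [Finset.mem_filter, Finset.mem_univ, true_and] at hi hj hk
    exact unipotentFun_no_three_agree (fun h => hpq (Prod.ext h.1 (Units.ext h.2)))
      hij hik hjk hi hj hk
  have hsum := Finset.card_filter_add_card_filter_not (s := Finset.univ) fun i =>
    unipotentPerm p.1 p.2 i = unipotentPerm q.1 q.2 i
  simp only [Finset.card_univ, Fintype.card_option] at hsum
  unfold hammingDist
  simp only [ne_eq]
  omega

end UnipotentCode

theorem hammingDist_permCongr {α β : Type*} [Fintype α] [Fintype β] [DecidableEq α]
    [DecidableEq β] (e : α ≃ β) (σ τ : Equiv.Perm α) :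
    hammingDist (e.permCongr σ) (e.permCongr τ) = hammingDist σ τ := by
  unfold hammingDist
  refine Finset.card_bij' (fun i _ => e.symm i) (fun i _ => e i) ?_ ?_ ?_ ?_ <;> simp

/-- `M(39, 37) ≥ 1301`: there exists a set of 1301 permutations of `Z_39` whose pairwise
Hamming distance is at least 37. -/
theorem M_39_37_ge_1301 :
    ∃ S : Finset (Equiv.Perm (Fin 39)), S.card = 1301 ∧
      ∀ σ ∈ S, ∀ τ ∈ S, σ ≠ τ → 37 ≤ hammingDist ⇑σ ⇑τ := by
  have : Fact (Nat.Prime 37) := ⟨by norm_num⟩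
  let e : Option (Option (ZMod 37)) ≃ Fin 39 :=
    Fintype.equivFinOfCardEq (by simp [ZMod.card])
  let f : ZMod 37 × (ZMod 37)ˣ → Equiv.Perm (Fin 39) :=
    fun p => e.permCongr (unipotentPerm p.1 p.2)
  have hdist : ∀ p q, p ≠ q → 37 ≤ hammingDist (f p) (f q) := by
    intro p q hpq
    have h := card_le_hammingDist_unipotentPerm hpq
    rw [ZMod.card] at h
    exact h.trans_eq (hammingDist_permCongr e _ _).symm
  have hinj : Function.Injective f := by
    intro p q h
    by_contra hpq
    have h37 := hdist p q hpq
    simp [h] at h37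
  have hcard : (Finset.univ.image f).card = 1332 := by
    rw [Finset.card_image_of_injective _ hinj, Finset.card_univ, Fintype.card_prod,
      ZMod.card, ZMod.card_units]
  obtain ⟨S, hS, hScard⟩ := Finset.exists_subset_card_eq (show 1301 ≤ _ by rw [hcard]; norm_num)
  refine ⟨S, hScard, fun σ hσ τ hτ hne => ?_⟩
  obtain ⟨p, -, rfl⟩ := Finset.mem_image.mp (hS hσ)
  obtain ⟨q, -, rfl⟩ := Finset.mem_image.mp (hS hτ)
  exact hdist p q fun h => hne (h ▸ rfl)
end

section
/- M(34, 32) ≥ 945: there exists a set of 945 permutations of Z_34 whose pairwise Hamming distance is at least 32. -/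
open Equiv Sum

/-- The extension of a permutation `f` of `F` to a permutation of `F` with two new points, where the
new symbols replace `f p` and `f q` at the positions `p` and `q`, and the displaced symbols move to
the new positions. -/
def divert {F : Type*} [DecidableEq F] (f : Perm F) (p q : F) : Perm (F ⊕ Fin 2) :=
  sumCongr f (1 : Perm (Fin 2)) * swap (inl p) (inr 0) * swap (inl q) (inr 1)

theorem divert_inl {F : Type*} [DecidableEq F] (f : Perm F) {p q : F} (h : p ≠ q) (x : F) :
    divert f p q (inl x) = if x = p then inr 0 else if x = q then inr 1 else inl (f x) := by
  simp only [divert, Perm.mul_apply, swap_apply_def]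
  split_ifs <;> simp_all

theorem divert_inr_zero {F : Type*} [DecidableEq F] (f : Perm F) (p q : F) :
    divert f p q (inr 0) = inl (f p) := by
  simp [divert, swap_apply_def]

theorem divert_inr_one {F : Type*} [DecidableEq F] (f : Perm F) {p q : F} (h : p ≠ q) :
    divert f p q (inr 1) = inl (f q) := by
  simp [divert, swap_apply_def, h.symm]

/-- If `f` and `g` agree at most once, and at most one of the four positions and symbols affected
by the diversions coincides, then the diverted permutations agree at most twice. -/
theorem exists_divert_agree {F : Type*} [DecidableEq F] {f g : Perm F} {p q p' q' : F}
    (h : p ≠ q) (h' : p' ≠ q') (hfg : ∀ x y, f x = g x → f y = g y → x = y)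
    (h₁ : ¬(p = p' ∧ q = q')) (h₂ : ¬(p = p' ∧ f p = g p')) (h₃ : ¬(p = p' ∧ f q = g q'))
    (h₄ : ¬(q = q' ∧ f p = g p')) (h₅ : ¬(q = q' ∧ f q = g q'))
    (h₆ : ¬(f p = g p' ∧ f q = g q')) :
    ∃ u v, ∀ z, divert f p q z = divert g p' q' z → z = u ∨ z = v := by
  obtain ⟨x₀, hx₀⟩ : ∃ x₀, ∀ x, f x = g x → x = x₀ := by
    by_cases hx : ∃ x, f x = g x
    · exact hx.imp fun x hx y hy => hfg y x hy hx
    · exact ⟨p, fun x hx' => (hx ⟨x, hx'⟩).elim⟩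
  refine ⟨inl x₀, if p = p' then inl p else if q = q' then inl q else
    if f p = g p' then inr 0 else inr 1, ?_⟩
  rintro (x | i) hz
  · rw [divert_inl f h, divert_inl g h'] at hz
    have := hx₀ x
    grind
  · fin_cases i
    · simp only [Fin.zero_eta, divert_inr_zero, inl.injEq] at hz ⊢
      grind
    · simp only [Fin.mk_one, divert_inr_one f h, divert_inr_one g h', inl.injEq] at hz ⊢
      grind

/-- The line of slope `w.2 / w.1` through `(x₀, y₀)`, as a permutation. -/
def linePerm {F : Type*} [Field F] (w : Fˣ × Fˣ) (x₀ y₀ : F) : Perm F where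
  toFun x := y₀ + (w.2 / w.1) * (x - x₀)
  invFun y := x₀ + (w.1 / w.2) * (y - y₀)
  left_inv x := by field_simp; ring
  right_inv y := by field_simp; ring

/-- First coordinate of `T w`, where `T` is a `2 × 2` matrix with `T ^ 2 + T + 1 = 0`. -/
def baseX {F : Type*} [Field F] (a : F) (w : Fˣ × Fˣ) : F := a * w.1 + w.2

/-- Second coordinate of `T w`, where `T` is a `2 × 2` matrix with `T ^ 2 + T + 1 = 0`. -/
def baseY {F : Type*} [Field F] (a : F) (w : Fˣ × Fˣ) : F :=
  (1 + a + a ^ 2) * w.1 + (1 + a) * w.2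

/-- The line through `T w` and `T w + w`, diverted at these two points. -/
def codePerm {F : Type*} [Field F] [DecidableEq F] (a : F) (w : Fˣ × Fˣ) : Perm (F ⊕ Fin 2) :=
  divert (linePerm w (baseX a w) (baseY a w)) (baseX a w) (baseX a w + w.1)

theorem linePerm_base {F : Type*} [Field F] (w : Fˣ × Fˣ) (x₀ y₀ : F) :
    linePerm w x₀ y₀ x₀ = y₀ := by
  simp [linePerm]

theorem linePerm_base_add {F : Type*} [Field F] (w : Fˣ × Fˣ) (x₀ y₀ : F) :
    linePerm w x₀ y₀ (x₀ + w.1) = y₀ + w.2 := by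
  simp [linePerm]

theorem linear_system_eq_zero {F : Type*} [Field F] {r s t u x y : F} (hdet : r * u - s * t ≠ 0)
    (h₁ : r * x + s * y = 0) (h₂ : t * x + u * y = 0) : x = 0 ∧ y = 0 := by
  constructor
  · refine (mul_eq_zero.1 ?_).resolve_left hdet
    linear_combination u * h₁ - s * h₂
  · refine (mul_eq_zero.1 ?_).resolve_left hdet
    linear_combination r * h₂ - t * h₁

/-- Distinct lines of the family meet at most once. -/
theorem linePerm_agree {F : Type*} [Field F] [CharP F 2] {a : F}
    (hF : ∀ x : F, x ^ 2 + x + 1 ≠ 0) {w v : Fˣ × Fˣ} (hwv : w ≠ v) (x y : F)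
    (hx : linePerm w (baseX a w) (baseY a w) x = linePerm v (baseX a v) (baseY a v) x)
    (hy : linePerm w (baseX a w) (baseY a w) y = linePerm v (baseX a v) (baseY a v) y) :
    x = y := by
  by_contra hxy
  have h2 : (2 : F) = 0 := CharTwo.two_eq_zero
  obtain ⟨m, hm⟩ : ∃ m : F, m = w.2 / w.1 := ⟨_, rfl⟩
  have hslope : (w.2 / w.1 : F) = v.2 / v.1 := by
    simp only [linePerm, coe_fn_mk] at hx hy
    refine mul_right_cancel₀ (sub_ne_zero.2 hxy) ?_
    linear_combination hx - hy
  have hw : (w.2 : F) = m * w.1 := by rw [hm]; field_simp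
  have hv : (v.2 : F) = m * v.1 := by rw [hm, hslope]; field_simp
  simp only [linePerm, coe_fn_mk, ← hslope, ← hm] at hx
  simp only [baseX, baseY, hw, hv] at hx
  have key : ((w.1 : F) - v.1) * ((m + a) ^ 2 + (m + a) + 1) = 0 := by
    linear_combination hx + ((w.1 : F) - v.1) * (m ^ 2 + m * a) * h2
  have h1 : (w.1 : F) = v.1 := sub_eq_zero.1 ((mul_eq_zero.1 key).resolve_right (hF _))
  exact hwv (Prod.ext (Units.ext h1) (Units.ext (by rw [hw, hv, h1])))

theorem exists_codePerm_agree {F : Type*} [Field F] [CharP F 2] [DecidableEq F] {a : F}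
    (hF : ∀ x : F, x ^ 2 + x + 1 ≠ 0) (ha₀ : a ≠ 0) (ha₁ : 1 + a ≠ 0) {w v : Fˣ × Fˣ}
    (hwv : w ≠ v) :
    ∃ x y, ∀ z, codePerm a w z = codePerm a v z → z = x ∨ z = y := by
  have h2 : (2 : F) = 0 := CharTwo.two_eq_zero
  have hγ : 1 + a + a ^ 2 ≠ 0 := fun h => hF a (by linear_combination h)
  have hsolve {r s t u : F} (hdet : r * u - s * t ≠ 0)
      (h₁ : r * (w.1 - v.1 : F) + s * (w.2 - v.2) = 0)
      (h₂ : t * (w.1 - v.1 : F) + u * (w.2 - v.2) = 0) : False := by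
    obtain ⟨h, h'⟩ := linear_system_eq_zero hdet h₁ h₂
    exact hwv (Prod.ext (Units.ext (sub_eq_zero.1 h)) (Units.ext (sub_eq_zero.1 h')))
  refine exists_divert_agree (by simp) (by simp) (linePerm_agree hF hwv) ?_ ?_ ?_ ?_ ?_ ?_ <;>
    simp only [linePerm_base, linePerm_base_add, baseX, baseY] <;> rintro ⟨h, h'⟩
  · refine hsolve (r := a) (s := 1) (t := a + 1) (u := 1) ?_
      (by linear_combination h) (by linear_combination h')
    ring_nf; simp
  · refine hsolve (r := a) (s := 1) (t := 1 + a + a ^ 2) (u := 1 + a) ?_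
      (by linear_combination h) (by linear_combination h')
    ring_nf; simp
  · refine hsolve (r := a) (s := 1) (t := 1 + a + a ^ 2) (u := 2 + a) ?_
      (by linear_combination h) (by linear_combination h')
    intro h0; apply ha₁; linear_combination -h0 + a * h2
  · refine hsolve (r := a + 1) (s := 1) (t := 1 + a + a ^ 2) (u := 1 + a) ?_
      (by linear_combination h) (by linear_combination h')
    intro h0; apply ha₀; linear_combination h0
  · refine hsolve (r := a + 1) (s := 1) (t := 1 + a + a ^ 2) (u := 2 + a) ?_
      (by linear_combination h) (by linear_combination h')
    intro h0; apply one_ne_zero (α := F); linear_combination h0 - a * h2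
  · refine hsolve (r := 1 + a + a ^ 2) (s := 1 + a) (t := 1 + a + a ^ 2) (u := 2 + a) ?_
      (by linear_combination h) (by linear_combination h')
    intro h0; apply hγ; linear_combination h0

theorem sq_add_self_add_one_ne_zero {F : Type*} [Field F] [Fintype F] [CharP F 2]
    (hcard : Fintype.card F = 32) (x : F) : x ^ 2 + x + 1 ≠ 0 := by
  intro hx
  have h2 : (2 : F) = 0 := CharTwo.two_eq_zero
  have h3 : x ^ 3 = 1 := by linear_combination (x - 1) * hx
  have h32 : x ^ 32 = x := by rw [← hcard]; exact FiniteField.pow_card x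
  have hxx : x ^ 2 = x := by
    calc x ^ 2 = (x ^ 3) ^ 10 * x ^ 2 := by rw [h3]; ring
      _ = x ^ 32 := by ring
      _ = x := h32
  apply one_ne_zero (α := F)
  linear_combination hx - hxx - x * h2

theorem hammingDist_permCongr_ge {α : Type*} [Fintype α] [DecidableEq α] {n : ℕ} (e : α ≃ Fin n)
    {σ τ : Perm α} (h : ∃ x y, ∀ z, σ z = τ z → z = x ∨ z = y) :
    n - 2 ≤ hammingDist ⇑(e.permCongr σ) ⇑(e.permCongr τ) := by
  obtain ⟨x, y, hxy⟩ := h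
  calc n - 2 ≤ Finset.card ({e x, e y} : Finset (Fin n))ᶜ := by
        rw [Finset.card_compl, Fintype.card_fin]
        exact Nat.sub_le_sub_left Finset.card_le_two n
    _ ≤ _ := by
        refine Finset.card_le_card fun z hz => Finset.mem_filter.2
          ⟨Finset.mem_univ _, fun hzz => ?_⟩
        have := hxy (e.symm z) (e.injective hzz)
        simp_all [e.symm_apply_eq]

/-- `M(34, 32) ≥ 945`: there exists a set of 945 permutations of `Z_34` whose pairwise
Hamming distance is at least 32. -/
theorem M_34_32_ge_945 :
    ∃ S : Finset (Equiv.Perm (Fin 34)), S.card = 945 ∧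
      ∀ σ ∈ S, ∀ τ ∈ S, σ ≠ τ → 32 ≤ hammingDist ⇑σ ⇑τ := by
  classical
  let F := GaloisField 2 5
  have : Fintype F := Fintype.ofFinite F
  have hcard : Fintype.card F = 32 := by
    rw [Fintype.card_eq_nat_card, GaloisField.card 2 5 (by norm_num)]
    norm_num
  obtain ⟨a, ha⟩ : ∃ a, a ∉ ({0, 1} : Finset F) := by
    by_contra! h
    have := (Finset.card_le_card fun x _ => h x : (Finset.univ : Finset F).card ≤ _).trans
      Finset.card_le_two
    rw [Finset.card_univ, hcard] at this
    omega
  simp only [Finset.mem_insert, Finset.mem_singleton, not_or] at ha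
  have ha₁ : 1 + a ≠ 0 := fun h => ha.2 (CharTwo.add_eq_zero.1 h).symm
  have e : (F ⊕ Fin 2) ≃ Fin 34 := Fintype.equivFinOfCardEq (by simp [hcard])
  have hdist {w v : Fˣ × Fˣ} (hwv : w ≠ v) :
      32 ≤ hammingDist ⇑(e.permCongr (codePerm a w)) ⇑(e.permCongr (codePerm a v)) :=
    hammingDist_permCongr_ge e
      (exists_codePerm_agree (sq_add_self_add_one_ne_zero hcard) ha.1 ha₁ hwv)
  have hinj : Function.Injective fun w : Fˣ × Fˣ => e.permCongr (codePerm a w) := by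
    intro w v hwv
    by_contra hne
    have := hdist hne
    simp_all
  have hunits : Fintype.card Fˣ = 31 := by
    rw [Fintype.card_eq_nat_card, Nat.card_units, ← Fintype.card_eq_nat_card, hcard]
  obtain ⟨W, -, hW⟩ := Finset.exists_subset_card_eq (s := (Finset.univ : Finset (Fˣ × Fˣ)))
    (n := 945) (by simp [hunits])
  refine ⟨W.image fun w => e.permCongr (codePerm a w), by
    rw [Finset.card_image_of_injective _ hinj, hW], ?_⟩
  simp only [Finset.mem_image]
  rintro _ ⟨w, -, rfl⟩ _ ⟨v, -, rfl⟩ hne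
  exact hdist fun h => hne (by rw [h])
end

section
/- M(66, 64) ≥ 4029: there exists a set of 4029 permutations of Z_66 whose pairwise Hamming distance is at least 64. -/
section Grafting

variable {F : Type*} [DecidableEq F]

/-- Extend a permutation `σ` of `F` to `F ⊕ Bool` by inserting the symbol `inr true` at position
`q` and moving the displaced symbol `σ q` to position `inr true`. -/
def graftOne (σ : Equiv.Perm F) (q : F) : Equiv.Perm (F ⊕ Bool) :=
  Equiv.sumCongr σ 1 * Equiv.swap (Sum.inl q) (Sum.inr true)

/-- Extend a permutation `σ` of `F` to `F ⊕ Bool` by inserting the symbols `inr false` and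
`inr true` at positions `p` and `q`, and moving the displaced symbols to the new positions. -/
def graftTwo (σ : Equiv.Perm F) (p q : F) : Equiv.Perm (F ⊕ Bool) :=
  Equiv.sumCongr σ 1 * Equiv.swap (Sum.inl p) (Sum.inr false) *
    Equiv.swap (Sum.inl q) (Sum.inr true)

theorem graftOne_inl (σ : Equiv.Perm F) (q x : F) :
    graftOne σ q (Sum.inl x) = if x = q then Sum.inr true else Sum.inl (σ x) := by
  by_cases h : x = q <;> simp [graftOne, Equiv.swap_apply_def, h]

theorem graftOne_true (σ : Equiv.Perm F) (q : F) :
    graftOne σ q (Sum.inr true) = Sum.inl (σ q) := by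
  simp [graftOne]

theorem graftOne_false (σ : Equiv.Perm F) (q : F) :
    graftOne σ q (Sum.inr false) = Sum.inr false := by
  simp [graftOne, Equiv.swap_apply_def]

theorem graftTwo_inl (σ : Equiv.Perm F) (p q x : F) :
    graftTwo σ p q (Sum.inl x) =
      if x = q then Sum.inr true else if x = p then Sum.inr false else Sum.inl (σ x) := by
  by_cases h : x = q <;> by_cases h' : x = p <;>
    simp [graftTwo, Equiv.swap_apply_def, h, h']
  all_goals grind

theorem graftTwo_true (σ : Equiv.Perm F) {p q : F} (hpq : p ≠ q) :
    graftTwo σ p q (Sum.inr true) = Sum.inl (σ q) := by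
  simp [graftTwo, Equiv.swap_apply_def, hpq.symm]

theorem graftTwo_false (σ : Equiv.Perm F) (p q : F) :
    graftTwo σ p q (Sum.inr false) = Sum.inl (σ p) := by
  simp [graftTwo, Equiv.swap_apply_def]

/-- Two maps agree in at most two points. -/
def AgreeAtMostTwo {α β : Type*} (f g : α → β) : Prop :=
  ∀ x y z, f x = g x → f y = g y → f z = g z → x = y ∨ x = z ∨ y = z

theorem AgreeAtMostTwo.symm {α β : Type*} {f g : α → β} (h : AgreeAtMostTwo f g) :
    AgreeAtMostTwo g f :=
  fun x y z hx hy hz => h x y z hx.symm hy.symm hz.symm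

theorem agreeAtMostTwo_graftTwo {σ τ : Equiv.Perm F} {p q p' q' : F} (hpq : p ≠ q)
    (hpq' : p' ≠ q') (hστ : ∀ x y, σ x = τ x → σ y = τ y → x = y)
    (h₁ : p = p' → q ≠ q') (h₂ : p = p' → σ q ≠ τ q') (h₃ : q = q' → σ p ≠ τ p')
    (h₄ : σ p = τ p' → σ q ≠ τ q') :
    AgreeAtMostTwo (graftTwo σ p q) (graftTwo τ p' q') := by
  have hF (x : F) (hx : graftTwo σ p q (Sum.inl x) = graftTwo τ p' q' (Sum.inl x)) :
      (x = p ∧ p = p') ∨ (x = q ∧ q = q') ∨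
        (x ≠ p ∧ x ≠ q ∧ x ≠ p' ∧ x ≠ q' ∧ σ x = τ x) := by
    simp only [graftTwo_inl] at hx
    clear hστ h₁ h₂ h₃ h₄
    split_ifs at hx <;> grind
  have ht (h : graftTwo σ p q (Sum.inr true) = graftTwo τ p' q' (Sum.inr true)) :
      σ q = τ q' := by
    simpa [graftTwo_true, hpq, hpq'] using h
  have hf (h : graftTwo σ p q (Sum.inr false) = graftTwo τ p' q' (Sum.inr false)) :
      σ p = τ p' := by
    simpa [graftTwo_false] using h
  rintro (x | _ | _) (y | _ | _) (z | _ | _) hx hy hz <;> grind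

theorem agreeAtMostTwo_graftOne_graftTwo {σ τ : Equiv.Perm F} {q p' q' : F}
    (hpq' : p' ≠ q') (hστ : ∀ x y, σ x = τ x → σ y = τ y → x = y) :
    AgreeAtMostTwo (graftOne σ q) (graftTwo τ p' q') := by
  have hF (x : F) (hx : graftOne σ q (Sum.inl x) = graftTwo τ p' q' (Sum.inl x)) :
      (x = q ∧ q = q') ∨ (x ≠ q ∧ x ≠ q' ∧ σ x = τ x) := by
    simp only [graftOne_inl, graftTwo_inl] at hx
    grind
  have ht (h : graftOne σ q (Sum.inr true) = graftTwo τ p' q' (Sum.inr true)) :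
      σ q = τ q' := by
    simpa [graftOne_true, graftTwo_true, hpq'] using h
  have hf : graftOne σ q (Sum.inr false) ≠ graftTwo τ p' q' (Sum.inr false) := by
    simp [graftOne_false, graftTwo_false]
  rintro (x | _ | _) (y | _ | _) (z | _ | _) hx hy hz <;> grind

theorem agreeAtMostTwo_graftOne {σ τ : Equiv.Perm F} {q q' : F}
    (hστ : ∀ x y, σ x = τ x → σ y = τ y → x = y) (hq : q ≠ q') (hσq : σ q ≠ τ q') :
    AgreeAtMostTwo (graftOne σ q) (graftOne τ q') := by
  have hF (x : F) (hx : graftOne σ q (Sum.inl x) = graftOne τ q' (Sum.inl x)) :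
      σ x = τ x := by
    simp only [graftOne_inl] at hx
    grind
  have ht : graftOne σ q (Sum.inr true) ≠ graftOne τ q' (Sum.inr true) := by
    simpa [graftOne_true] using hσq
  rintro (x | _ | _) (y | _ | _) (z | _ | _) hx hy hz <;> grind

end Grafting

section GraftedLines

variable {F : Type*} [Field F]

/-- The affine permutation `x ↦ a * x + b`. -/
def affineLine (a : Fˣ) (b : F) : Equiv.Perm F :=
  (Units.mulLeft a).trans (Equiv.addRight b)

theorem affineLine_apply (a : Fˣ) (b x : F) : affineLine a b x = a * x + b := rfl

theorem affineLine_agree {i j : Fˣ × F} (hij : i ≠ j) (x y : F)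
    (hx : affineLine i.1 i.2 x = affineLine j.1 j.2 x)
    (hy : affineLine i.1 i.2 y = affineLine j.1 j.2 y) : x = y := by
  obtain ⟨a, b⟩ := i
  obtain ⟨a', b'⟩ := j
  simp only [affineLine_apply] at hx hy
  have h : ((a : F) - a') * (x - y) = 0 := by linear_combination hx - hy
  rcases mul_eq_zero.1 h with h | h
  · have ha : a = a' := Units.ext (sub_eq_zero.1 h)
    subst ha
    exact absurd (by rw [add_left_cancel hx]) hij
  · exact sub_eq_zero.1 h

/-- The scale factor of the insertion points on the line `y = a * x + b`. -/
def lineScale (c : F) (i : Fˣ × F) : F := i.2 / ((i.1 : F) * i.1 + i.1 + c)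

/-- The extension of the line `y = a * x + b` to `F ⊕ Bool`. -/
def graftedLine [DecidableEq F] (c : F) (i : Fˣ × F) : Equiv.Perm (F ⊕ Bool) :=
  if i.2 = 0 then graftOne (affineLine i.1 i.2) i.1
  else graftTwo (affineLine i.1 i.2) (lineScale c i * i.1) (lineScale c i * (i.1 + 1))

theorem lineScale_inj [CharP F 2] {c : F} (hc : ∀ x : F, x * x + x + c ≠ 0) {i j : Fˣ × F}
    (hi : i.2 ≠ 0) (hd : lineScale c i = lineScale c j)
    (hp : lineScale c i * i.1 = lineScale c j * j.1) : i = j := by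
  have hd0 : lineScale c i ≠ 0 := div_ne_zero hi (hc _)
  rw [← hd] at hp
  have ha : i.1 = j.1 := Units.ext (mul_left_cancel₀ hd0 hp)
  refine Prod.ext ha ?_
  rw [lineScale, lineScale, ha] at hd
  exact (div_left_inj' (hc _)).1 hd

theorem agreeAtMostTwo_graftedLine [DecidableEq F] [CharP F 2] {c : F}
    (hc : ∀ x : F, x * x + x + c ≠ 0) (hc₁ : c ≠ 1) {i j : Fˣ × F} (hij : i ≠ j) :
    AgreeAtMostTwo (graftedLine c i) (graftedLine c j) := by
  have h2 : (2 : F) = 0 := CharTwo.two_eq_zero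
  have hc₀ : c ≠ 0 := fun h => hc 0 (by simp [h])
  have hpq (k : Fˣ × F) (hk : k.2 ≠ 0) :
      lineScale c k * k.1 ≠ lineScale c k * (k.1 + 1) := by
    intro h
    exact div_ne_zero hk (hc _) (show lineScale c k = 0 by linear_combination -h)
  have hb (k : Fˣ × F) : k.2 = lineScale c k * ((k.1 : F) * k.1 + k.1 + c) :=
    (div_mul_cancel₀ _ (hc _)).symm
  have hu (k : Fˣ × F) : affineLine k.1 k.2 (lineScale c k * k.1) =
      lineScale c k * k.1 + lineScale c k * c := by
    rw [affineLine_apply]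
    linear_combination hb k + (lineScale c k * k.1 * k.1) * h2
  have hv (k : Fˣ × F) : affineLine k.1 k.2 (lineScale c k * (k.1 + 1)) =
      lineScale c k * c := by
    rw [affineLine_apply]
    linear_combination hb k + (lineScale c k * k.1 * k.1 + lineScale c k * k.1) * h2
  have hsq (a a' : Fˣ) (h : (a : F) * a = a' * a') : a = a' := by
    refine Units.ext (sub_eq_zero.1 (mul_self_eq_zero.1 ?_))
    linear_combination h + (a' * a' - a * a' : F) * h2
  have hστ := affineLine_agree hij
  by_cases hi : i.2 = 0 <;> by_cases hj : j.2 = 0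
  · have ha : i.1 ≠ j.1 := fun h => hij (Prod.ext h (hi.trans hj.symm))
    simp only [graftedLine, hi, hj, if_true] at hστ ⊢
    refine agreeAtMostTwo_graftOne hστ (fun h => ha (Units.ext h)) fun h => ha (hsq _ _ ?_)
    simpa [affineLine_apply] using h
  · simp only [graftedLine, if_pos hi, if_neg hj]
    exact agreeAtMostTwo_graftOne_graftTwo (hpq j hj) hστ
  · simp only [graftedLine, if_neg hi, if_pos hj]
    exact (agreeAtMostTwo_graftOne_graftTwo (hpq i hi)
      fun x y hx hy => hστ x y hx.symm hy.symm).symm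
  · simp only [graftedLine, if_neg hi, if_neg hj]
    refine agreeAtMostTwo_graftTwo (hpq i hi) (hpq j hj) hστ ?_ ?_ ?_ ?_
    · intro hp hq
      exact hij (lineScale_inj hc hi (by linear_combination hq - hp) hp)
    · rw [hv, hv]
      intro hp hv'
      exact hij (lineScale_inj hc hi (mul_right_cancel₀ hc₀ hv') hp)
    · rw [hu, hu]
      intro hq hu'
      have hd : lineScale c i = lineScale c j :=
        mul_right_cancel₀ (sub_ne_zero.2 hc₁) (by linear_combination hu' - hq)
      exact hij (lineScale_inj hc hi hd (by linear_combination hq - hd))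
    · rw [hu, hu, hv, hv]
      intro hu' hv'
      exact hij (lineScale_inj hc hi (mul_right_cancel₀ hc₀ hv')
        (by linear_combination hu' - hv'))

end GraftedLines

theorem card_le_hammingDist_add_two {α β : Type*} [Fintype α] [DecidableEq β] {f g : α → β}
    (h : AgreeAtMostTwo f g) : Fintype.card α ≤ hammingDist f g + 2 := by
  classical
  have hle : (Finset.univ.filter fun x => f x = g x).card ≤ 2 := by
    by_contra! hlt
    obtain ⟨x, y, z, hx, hy, hz, hxy, hxz, hyz⟩ := Finset.two_lt_card_iff.1 hlt
    simp only [Finset.mem_filter, Finset.mem_univ, true_and] at hx hy hz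
    rcases h x y z hx hy hz with h | h | h <;> contradiction
  have hsum := Finset.card_filter_add_card_filter_not (s := (Finset.univ : Finset α))
    (fun x => f x = g x)
  rw [Finset.card_univ] at hsum
  have hd : hammingDist f g = (Finset.univ.filter fun x => ¬ f x = g x).card := rfl
  omega

/-- A finite field of characteristic two with a primitive cube root
of unity has an element `c ≠ 1` for which `x ^ 2 + x + c` has no root. -/
theorem exists_add_ne_zero {F : Type*} [Field F] [Finite F] [CharP F 2]
    (h3 : 3 ∣ Nat.card Fˣ) : ∃ c : F, c ≠ 1 ∧ ∀ x : F, x * x + x + c ≠ 0 := by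
  have h2 : (2 : F) = 0 := CharTwo.two_eq_zero
  have hinj : ¬ Function.Injective fun x : F => x * x + x := fun h =>
    zero_ne_one (h (show (0 : F) * 0 + 0 = 1 * 1 + 1 by linear_combination -h2))
  have hsurj : ¬ Function.Surjective fun x : F => x * x + x :=
    fun h => hinj (Finite.injective_iff_surjective.2 h)
  simp only [Function.Surjective, not_forall, not_exists] at hsurj
  obtain ⟨c, hc⟩ := hsurj
  have : Fact (Nat.Prime 3) := ⟨Nat.prime_three⟩
  obtain ⟨w, hw⟩ := exists_prime_orderOf_dvd_card' 3 h3
  have hw3 : (w : F) ^ 3 = 1 := by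
    rw [← Units.val_pow_eq_pow_val, ← hw, pow_orderOf_eq_one, Units.val_one]
  have hw1 : (w : F) - 1 ≠ 0 := by
    intro h
    have : w = 1 := Units.ext (sub_eq_zero.1 h)
    rw [this, orderOf_one] at hw
    omega
  refine ⟨c, ?_, fun x hx => hc x (by linear_combination hx - c * h2)⟩
  rintro rfl
  refine hc w (mul_left_cancel₀ hw1 ?_)
  linear_combination hw3 - (w - 1 : F) * h2

/-- `M(66, 64) ≥ 4029`: there exists a set of 4029 permutations of `Z_66` whose pairwise
Hamming distance is at least 64. -/
theorem M_66_64_ge_4029 :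
    ∃ S : Finset (Equiv.Perm (Fin 66)), S.card = 4029 ∧
      ∀ σ ∈ S, ∀ τ ∈ S, σ ≠ τ → 64 ≤ hammingDist ⇑σ ⇑τ := by
  classical
  have : Fact (Nat.Prime 2) := ⟨Nat.prime_two⟩
  let F := GaloisField 2 6
  let : Fintype F := Fintype.ofFinite F
  have hF : Nat.card F = 64 := by
    rw [GaloisField.card 2 6 (by norm_num)]
    norm_num
  have hU : Nat.card Fˣ = 63 := by rw [Nat.card_units, hF]
  obtain ⟨c, hc₁, hc⟩ := exists_add_ne_zero (F := F) (by rw [hU]; norm_num)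
  have hcard : Fintype.card (F ⊕ Bool) = 66 := by
    rw [Fintype.card_sum, ← Nat.card_eq_fintype_card, hF, Fintype.card_bool]
  let e : F ⊕ Bool ≃ Fin 66 := Fintype.equivFinOfCardEq hcard
  let f (i : Fˣ × F) : Equiv.Perm (Fin 66) := e.permCongr (graftedLine c i)
  have hdist {i j : Fˣ × F} (hij : i ≠ j) : 64 ≤ hammingDist (f i) (f j) := by
    have h : AgreeAtMostTwo (f i) (f j) := fun x y z hx hy hz => by
      simpa using agreeAtMostTwo_graftedLine hc hc₁ hij (e.symm x) (e.symm y) (e.symm z)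
        (e.injective hx) (e.injective hy) (e.injective hz)
    have := card_le_hammingDist_add_two h
    rw [Fintype.card_fin] at this
    omega
  have hf : Function.Injective f := by
    intro i j h
    by_contra hij
    have := hdist hij
    rw [h, hammingDist_self] at this
    omega
  have hT : 4029 ≤ (Finset.univ.image f).card := by
    rw [Finset.card_image_of_injective _ hf, Finset.card_univ, ← Nat.card_eq_fintype_card,
      Nat.card_prod, hU, hF]
    norm_num
  obtain ⟨S, hS, hScard⟩ := Finset.exists_subset_card_eq hT
  refine ⟨S, hScard, fun σ hσ τ hτ hne => ?_⟩
  obtain ⟨i, -, rfl⟩ := Finset.mem_image.1 (hS hσ)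
  obtain ⟨j, -, rfl⟩ := Finset.mem_image.1 (hS hτ)
  exact hdist fun h => hne (congrArg f h)
end

section
/- M(40, 34) ≥ 287437: there exists a set of 287437 permutations of Z_40 whose pairwise Hamming distance is at least 34. -/
open Polynomial

section DoublingMap

variable {F : Type*} [Field F]

/-- The `x`-coordinate of the doubling map on the curve `y² = x³ + b x + c`, up to a factor `4`. -/
def doublingMap (b c x : F) : F :=
  (x ^ 4 - 2 * b * x ^ 2 - 8 * c * x + b ^ 2) / (x ^ 3 + b * x + c)

/-- If `x³ + b x + c` has no root, i.e. the curve has no rational `2`-torsion, then the doubling map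
is injective on `x`-coordinates. -/
theorem doublingMap_injective (h2 : (2 : F) ≠ 0) {b c : F}
    (hc : ∀ t : F, t ^ 3 + b * t + c ≠ 0) : Function.Injective (doublingMap b c) := by
  intro x y hxy
  by_contra hne
  rw [doublingMap, doublingMap, div_eq_div_iff (hc x) (hc y)] at hxy
  set s := x + y with hs
  set p := x * y with hp
  set r₁ := s ^ 2 + 2 * b + 2 * p with hr₁
  set r₀ := 4 * c + s * (b - p) with hr₀
  have hres : 2 * r₀ ^ 2 - s * r₀ * r₁ + (b - p) * r₁ ^ 2 = 0 := by
    refine (mul_eq_zero.1 ?_).resolve_left (sub_ne_zero.2 hne)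
    rw [hr₁, hr₀, hs, hp]
    linear_combination (-4) * hxy
  have h4 : (4 : F) ≠ 0 := by
    have : (4 : F) = 2 * 2 := by norm_num
    rw [this]
    exact mul_ne_zero h2 h2
  have hdiv : ∀ t : F, 4 * (t ^ 3 + b * t + c) =
      (2 * t - s) * (2 * t ^ 2 + s * t + (b - p)) + (r₁ * t + r₀) := by
    intro t
    rw [hr₁, hr₀]
    ring
  by_cases hr : r₁ = 0
  · have hr0 : r₀ = 0 := by simpa [hr, h2] using hres
    refine hc (s / 2) ((mul_eq_zero.1 ((hdiv _).trans ?_)).resolve_left h4)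
    rw [hr, hr0]
    field_simp
    ring
  · refine hc (-r₀ / r₁) ((mul_eq_zero.1 ((hdiv _).trans ?_)).resolve_left h4)
    have hq : 2 * (-r₀ / r₁) ^ 2 + s * (-r₀ / r₁) + (b - p) = 0 := by
      have : 2 * (-r₀ / r₁) ^ 2 + s * (-r₀ / r₁) + (b - p) =
          (2 * r₀ ^ 2 - s * r₀ * r₁ + (b - p) * r₁ ^ 2) / r₁ ^ 2 := by
        field_simp
        ring
      rw [this, hres, zero_div]
    rw [hq, mul_div_cancel₀ _ hr]
    ring

/-- The doubling map composed with affine maps so that it fixes `0`. -/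
def affineDoubling (h b c a x : F) : F :=
  a * (doublingMap b c (x + h) - doublingMap b c h)

theorem affineDoubling_zero (h b c a : F) : affineDoubling h b c a 0 = 0 := by
  simp [affineDoubling]

theorem affineDoubling_injective (h2 : (2 : F) ≠ 0) (h : F) {b c a : F}
    (hc : ∀ t : F, t ^ 3 + b * t + c ≠ 0) (ha : a ≠ 0) :
    Function.Injective (affineDoubling h b c a) := by
  intro x y hxy
  have := mul_left_cancel₀ ha hxy
  exact add_right_cancel (doublingMap_injective h2 hc (sub_left_injective this))

/-- The cubic polynomial `(X + h)³ + b (X + h) + c`. -/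
noncomputable def shiftedCubic (h b c : F) : F[X] :=
  (X + C h) ^ 3 + C b * (X + C h) + C c

/-- The numerator of `affineDoubling h b c a`, over the denominator `shiftedCubic h b c`. -/
noncomputable def affineDoublingNum (h b c a : F) : F[X] :=
  C a * ((X + C h) ^ 4 - C (2 * b) * (X + C h) ^ 2 - C (8 * c) * (X + C h) + C (b ^ 2)
    - C (doublingMap b c h) * shiftedCubic h b c)

theorem shiftedCubic_eq (h b c : F) : shiftedCubic h b c =
    X ^ 3 + C (3 * h) * X ^ 2 + C (3 * h ^ 2 + b) * X + C (h ^ 3 + b * h + c) := by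
  simp only [shiftedCubic, map_add, map_mul, map_pow, map_ofNat]
  ring

theorem eval_shiftedCubic (h b c x : F) :
    (shiftedCubic h b c).eval x = (x + h) ^ 3 + b * (x + h) + c := by
  simp [shiftedCubic]

theorem natDegree_shiftedCubic (h b c : F) : (shiftedCubic h b c).natDegree = 3 := by
  rw [shiftedCubic_eq]
  compute_degree!

theorem monic_shiftedCubic (h b c : F) : (shiftedCubic h b c).Monic := by
  rw [shiftedCubic_eq]
  monicity!

theorem shiftedCubic_inj (h3 : (3 : F) ≠ 0) {h b c h' b' c' : F}
    (H : shiftedCubic h b c = shiftedCubic h' b' c') : h = h' ∧ b = b' ∧ c = c' := by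
  rw [shiftedCubic_eq, shiftedCubic_eq] at H
  have e2 := congrArg (coeff · 2) H
  have e1 := congrArg (coeff · 1) H
  have e0 := congrArg (coeff · 0) H
  simp only [coeff_add, coeff_C_mul, coeff_X_pow, coeff_X, coeff_C] at e2 e1 e0
  have hh : h = h' := by simpa [h3] using e2
  subst hh
  have hb : b = b' := by simpa using e1
  subst hb
  exact ⟨rfl, rfl, by simpa using e0⟩

theorem irreducible_shiftedCubic (h : F) {b c : F} (hc : ∀ t : F, t ^ 3 + b * t + c ≠ 0) :
    Irreducible (shiftedCubic h b c) := by
  rw [irreducible_iff_roots_eq_zero_of_degree_le_three (by rw [natDegree_shiftedCubic]; norm_num)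
    (by rw [natDegree_shiftedCubic])]
  refine Multiset.eq_zero_of_forall_notMem fun t ht => ?_
  have := isRoot_of_mem_roots ht
  rw [IsRoot, eval_shiftedCubic] at this
  exact hc _ this

theorem natDegree_affineDoublingNum_le (h b c a : F) :
    (affineDoublingNum h b c a).natDegree ≤ 4 := by
  rw [affineDoublingNum, shiftedCubic]
  compute_degree

theorem coeff_affineDoublingNum (h b c a : F) : (affineDoublingNum h b c a).coeff 4 = a := by
  rw [affineDoublingNum, shiftedCubic_eq]
  have : (X + C h) ^ 4 = X ^ 4 + C (4 * h) * X ^ 3 + C (6 * h ^ 2) * X ^ 2 + C (4 * h ^ 3) * X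
      + C (h ^ 4) := by
    simp only [map_mul, map_pow, map_ofNat]
    ring
  rw [this]
  have : (X + C h) ^ 2 = X ^ 2 + C (2 * h) * X + C (h ^ 2) := by
    simp only [map_mul, map_pow, map_ofNat]
    ring
  rw [this]
  simp only [coeff_C_mul, coeff_add, coeff_sub, coeff_X_pow, coeff_X, coeff_C]
  norm_num

theorem affineDoubling_eq_div (h b c a x : F) (hc : ∀ t : F, t ^ 3 + b * t + c ≠ 0) :
    affineDoubling h b c a x =
      (affineDoublingNum h b c a).eval x / (shiftedCubic h b c).eval x := by
  have := hc (x + h)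
  rw [affineDoublingNum, eval_shiftedCubic, affineDoubling, doublingMap.eq_1 b c (x + h)]
  simp only [eval_mul, eval_sub, eval_add, eval_pow, eval_C, eval_X, eval_shiftedCubic]
  rw [mul_div_assoc, sub_div, mul_div_cancel_right₀ _ this]

theorem not_shiftedCubic_dvd_num (h3 : (3 : F) ≠ 0) (h : F) {b c a : F}
    (hc : ∀ t : F, t ^ 3 + b * t + c ≠ 0) (ha : a ≠ 0) :
    ¬ shiftedCubic h b c ∣ affineDoublingNum h b c a := by
  intro hdvd
  have hrem : affineDoublingNum h b c a =
      C a * (X + C h - C (doublingMap b c h)) * shiftedCubic h b c -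
      C a * (C (3 * b) * X ^ 2 + C (6 * b * h + 9 * c) * X
        + C (3 * b * h ^ 2 + 9 * c * h - b ^ 2)) := by
    simp only [affineDoublingNum, shiftedCubic, map_add, map_sub, map_mul, map_pow, map_ofNat]
    ring
  rw [hrem, dvd_sub_right (dvd_mul_left _ _),
    (isUnit_C.2 ha.isUnit).dvd_mul_left] at hdvd
  have hzero := eq_zero_of_dvd_of_natDegree_lt hdvd (by
    rw [natDegree_shiftedCubic]
    exact lt_of_le_of_lt natDegree_quadratic_le (by norm_num))
  have e2 := congrArg (coeff · 2) hzero
  have e1 := congrArg (coeff · 1) hzero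
  simp only [coeff_add, coeff_C_mul, coeff_X_pow, coeff_X, coeff_C, coeff_zero] at e2 e1
  have hb : b = 0 := by simpa [h3] using e2
  have h9 : (9 : F) ≠ 0 := by
    have : (9 : F) = 3 * 3 := by norm_num
    rw [this]
    exact mul_ne_zero h3 h3
  have hcz : c = 0 := by simpa [hb, h9] using e1
  exact hc 0 (by simp [hb, hcz])

/-- Distinct parameters give maps that agree in at most seven points. -/
theorem card_le_of_affineDoubling_eq [DecidableEq F] (h3 : (3 : F) ≠ 0) {h b c a h' b' c' a' : F}
    (hc : ∀ t : F, t ^ 3 + b * t + c ≠ 0) (hc' : ∀ t : F, t ^ 3 + b' * t + c' ≠ 0)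
    (ha : a ≠ 0) (hne : (h, (b, c), a) ≠ (h', (b', c'), a')) (A : Finset F)
    (hA : ∀ x ∈ A, affineDoubling h b c a x = affineDoubling h' b' c' a' x) : A.card ≤ 7 := by
  set P := affineDoublingNum h b c a * shiftedCubic h' b' c' -
    affineDoublingNum h' b' c' a' * shiftedCubic h b c with hP
  have hP0 : P ≠ 0 := by
    intro hP0
    rw [hP, sub_eq_zero] at hP0
    have hdvd : shiftedCubic h b c ∣ affineDoublingNum h b c a * shiftedCubic h' b' c' :=
      ⟨_, hP0.trans (mul_comm _ _)⟩
    have hdvd' := ((irreducible_shiftedCubic h hc).prime.dvd_or_dvd hdvd).resolve_left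
      (not_shiftedCubic_dvd_num h3 h hc ha)
    have heq := eq_of_monic_of_dvd_of_natDegree_le (monic_shiftedCubic h b c)
      (monic_shiftedCubic h' b' c') hdvd' (by simp only [natDegree_shiftedCubic, le_refl])
    rw [heq] at hP0
    have hnum := mul_right_cancel₀ (monic_shiftedCubic h b c).ne_zero hP0
    have haa := congrArg (coeff · 4) hnum
    simp only [coeff_affineDoublingNum] at haa
    obtain ⟨rfl, rfl, rfl⟩ := shiftedCubic_inj h3 heq
    exact hne (by rw [haa])
  have hdeg : P.natDegree ≤ 7 := by
    refine (natDegree_sub_le _ _).trans (max_le ?_ ?_)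
    all_goals
      refine natDegree_mul_le.trans ?_
      rw [natDegree_shiftedCubic]
      have := natDegree_affineDoublingNum_le h b c a
      have := natDegree_affineDoublingNum_le h' b' c' a'
      lia
  have hsub : A ⊆ P.roots.toFinset := by
    intro x hx
    rw [Multiset.mem_toFinset, mem_roots hP0, IsRoot, hP, eval_sub, eval_mul, eval_mul]
    have := hA x hx
    rw [affineDoubling_eq_div _ _ _ _ _ hc, affineDoubling_eq_div _ _ _ _ _ hc',
      div_eq_div_iff (by rw [eval_shiftedCubic]; exact hc _)
        (by rw [eval_shiftedCubic]; exact hc' _)] at this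
    rw [this, sub_self]
  exact (Finset.card_le_card hsub).trans
    ((Multiset.toFinset_card_le _).trans ((card_roots' P).trans hdeg))

end DoublingMap

/-- An injective self-map of a finite pointed type fixing the base point permutes the other
points. -/
theorem exists_perm_of_injective {α ι : Type*} [Finite ι] {z : α} (e : ι ≃ {x : α // x ≠ z})
    {f : α → α} (hf : Function.Injective f) (hz : f z = z) :
    ∃ σ : Equiv.Perm ι, ∀ i, (e (σ i) : α) = f (e i) := by
  have hfe (i : ι) : f (e i) ≠ z := fun h => (e i).2 (hf (h.trans hz.symm))
  let g : ι → ι := fun i => e.symm ⟨f (e i), hfe i⟩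
  have hg : Function.Injective g := by
    intro i j hij
    have := congrArg Subtype.val (e.symm.injective hij)
    exact e.injective (Subtype.ext (hf this))
  exact ⟨Equiv.ofBijective g (Finite.injective_iff_bijective.1 hg), fun i => by simp [g]⟩

theorem rootless_cubic_scale {F : Type*} [Field F] {b u : F}
    (hb : ∀ t : F, t ^ 3 + b * t + 1 ≠ 0) (hu : u ≠ 0) (t : F) :
    t ^ 3 + b * u ^ 2 * t + u ^ 3 ≠ 0 := by
  have : t ^ 3 + b * u ^ 2 * t + u ^ 3 = u ^ 3 * ((t / u) ^ 3 + b * (t / u) + 1) := by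
    field_simp
  rw [this]
  exact mul_ne_zero (pow_ne_zero 3 hu) (hb _)

theorem card_rootless_cubics_zmod_41 :
    (Finset.univ.filter fun b : ZMod 41 => ∀ t : ZMod 41, t ^ 3 + b * t + 1 ≠ 0).card = 14 := by
  decide +kernel

theorem cube_injective_zmod_41 : Function.Injective fun u : ZMod 41 => u ^ 3 := by
  have hinv : ∀ u : ZMod 41, (u ^ 3) ^ 27 = u := by decide +kernel
  exact Function.LeftInverse.injective (g := fun u => u ^ 27) hinv

theorem exists_params_zmod_41 [Fact (Nat.Prime 41)] :
    ∃ T : Finset (ZMod 41 × (ZMod 41 × ZMod 41) × ZMod 41), T.card = 918400 ∧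
      ∀ q ∈ T, (∀ t : ZMod 41, t ^ 3 + q.2.1.1 * t + q.2.1.2 ≠ 0) ∧ q.2.2 ≠ 0 := by
  obtain ⟨B, hBcard, hB⟩ : ∃ B : Finset (ZMod 41), B.card = 14 ∧
      ∀ b ∈ B, ∀ t : ZMod 41, t ^ 3 + b * t + 1 ≠ 0 :=
    ⟨_, card_rootless_cubics_zmod_41, by simp⟩
  obtain ⟨U, hUcard, hU⟩ : ∃ U : Finset (ZMod 41), U.card = 40 ∧ ∀ u ∈ U, u ≠ 0 :=
    ⟨Finset.univ.erase 0, by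
      rw [Finset.card_erase_of_mem (Finset.mem_univ _), Finset.card_univ, ZMod.card], by simp⟩
  let scale (p : ZMod 41 × ZMod 41) : ZMod 41 × ZMod 41 := (p.1 * p.2 ^ 2, p.2 ^ 3)
  have hscale : Set.InjOn scale ↑(B ×ˢ U) := by
    rintro ⟨b, u⟩ hbu ⟨b', u'⟩ - heq
    have hu : u ≠ 0 := hU _ (Finset.mem_product.1 hbu).2
    obtain rfl : u = u' := cube_injective_zmod_41 (congrArg Prod.snd heq)
    have hb : b = b' := mul_right_cancel₀ (pow_ne_zero 2 hu) (congrArg Prod.fst heq)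
    rw [hb]
  refine ⟨Finset.univ ×ˢ (B ×ˢ U).image scale ×ˢ U, ?_, ?_⟩
  · rw [Finset.card_product, Finset.card_product, Finset.card_image_of_injOn hscale,
      Finset.card_product, hBcard, hUcard, Finset.card_univ, ZMod.card]
  · rintro ⟨h, p, a⟩ hq
    simp only [Finset.mem_product, Finset.mem_image] at hq
    obtain ⟨-, ⟨⟨b, u⟩, ⟨hb, hu⟩, rfl⟩, ha⟩ := hq
    exact ⟨rootless_cubic_scale (hB b hb) (hU u hu), hU a ha⟩

/-- `M(40, 34) ≥ 287437`: there exists a set of 287437 permutations of `Z_40` whose pairwise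
Hamming distance is at least 34. -/
theorem M_40_34_ge_287437 :
    ∃ S : Finset (Equiv.Perm (Fin 40)), S.card = 287437 ∧
      ∀ σ ∈ S, ∀ τ ∈ S, σ ≠ τ → 34 ≤ hammingDist ⇑σ ⇑τ := by
  have h2 : (2 : ZMod 41) ≠ 0 := by decide
  have h3 : (3 : ZMod 41) ≠ 0 := by decide
  have : Fact (Nat.Prime 41) := ⟨by norm_num⟩
  obtain ⟨e⟩ : Nonempty (Fin 40 ≃ {x : ZMod 41 // x ≠ 0}) :=
    ⟨(Fintype.equivFinOfCardEq (by rw [Fintype.card_subtype_compl]; simp [ZMod.card])).symm⟩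
  obtain ⟨T, hT, hTmem⟩ := exists_params_zmod_41
  have hσ : ∀ q : T, ∃ σ : Equiv.Perm (Fin 40), ∀ i, (e (σ i) : ZMod 41) =
      affineDoubling q.1.1 q.1.2.1.1 q.1.2.1.2 q.1.2.2 (e i) := fun q =>
    exists_perm_of_injective e
      (affineDoubling_injective h2 _ (hTmem q q.2).1 (hTmem q q.2).2)
      (affineDoubling_zero _ _ _ _)
  choose σ hσ using hσ
  have hdist : ∀ q q' : T, q ≠ q' → 34 ≤ hammingDist ⇑(σ q) ⇑(σ q') := by
    intro q q' hqq'
    let E : Finset (Fin 40) := Finset.univ.filter fun i => σ q i = σ q' i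
    have hcard := card_le_of_affineDoubling_eq h3 (hTmem q q.2).1 (hTmem q' q'.2).1
      (hTmem q q.2).2 (fun h => hqq' (Subtype.ext h))
      (insert 0 (E.image fun i => (e i : ZMod 41))) (by
        intro x hx
        rw [Finset.mem_insert, Finset.mem_image] at hx
        obtain rfl | ⟨i, hi, rfl⟩ := hx
        · rw [affineDoubling_zero, affineDoubling_zero]
        · rw [← hσ q i, ← hσ q' i, (Finset.mem_filter.1 hi).2])
    rw [Finset.card_insert_of_notMem (by
        rw [Finset.mem_image]
        rintro ⟨i, -, hi⟩
        exact (e i).2 hi),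
      Finset.card_image_of_injective (f := fun i => (e i : ZMod 41)) _
        (Subtype.val_injective.comp e.injective)] at hcard
    have hsum : E.card + hammingDist ⇑(σ q) ⇑(σ q') = 40 := by
      have := Finset.card_filter_add_card_filter_not (s := (Finset.univ : Finset (Fin 40)))
        (fun i => σ q i = σ q' i)
      rwa [Finset.card_univ, Fintype.card_fin] at this
    lia
  have hinj : Function.Injective σ := by
    intro q q' h
    by_contra hne
    have := hdist q q' hne
    rw [h, hammingDist_self] at this
    lia
  obtain ⟨S, hS, hScard⟩ := Finset.exists_subset_card_eq
    (s := (Finset.univ : Finset T).image σ) (n := 287437) (by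
      rw [Finset.card_image_of_injective _ hinj, Finset.card_univ, Fintype.card_coe, hT]
      norm_num)
  refine ⟨S, hScard, fun s hs t ht hst => ?_⟩
  obtain ⟨q, -, rfl⟩ := Finset.mem_image.1 (hS hs)
  obtain ⟨q', -, rfl⟩ := Finset.mem_image.1 (hS ht)
  exact hdist q q' fun h => hst (h ▸ rfl)
end

section
/- M(43, 37) ≥ 369948: there exists a set of 369948 permutations of Z_43 whose pairwise Hamming distance is at least 37. -/
open Polynomial in
/-- Permutations induced by distinct polynomials of degree at most `k` agree in at most `k`
points. -/
theorem card_sub_le_hammingDist_eval {F : Type*} [Field F] [Fintype F] [DecidableEq F] {k : ℕ}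
    {p q : F[X]} (hp : p.natDegree ≤ k) (hq : q.natDegree ≤ k) (hpq : p ≠ q) :
    Fintype.card F - k ≤ hammingDist (fun x => p.eval x) (fun x => q.eval x) := by
  have hroots : (Finset.univ.filter fun x => p.eval x = q.eval x).card ≤ k := by
    refine (Finset.card_le_card ?_).trans ((Multiset.toFinset_card_le (p - q).roots).trans
      ((card_roots' _).trans ((natDegree_sub_le _ _).trans (max_le hp hq))))
    intro x hx
    simp only [Finset.mem_filter, Finset.mem_univ, true_and] at hx
    simp [sub_ne_zero.mpr hpq, hx]
  have hsplit := Finset.card_filter_add_card_filter_not (s := (Finset.univ : Finset F))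
    (fun x => p.eval x = q.eval x)
  rw [Finset.card_univ] at hsplit
  simp only [hammingDist]
  change _ ≤ (Finset.univ.filter fun x => ¬ p.eval x = q.eval x).card
  omega

section Dickson

variable {F : Type*} [Field F]

/-- The Dickson polynomial `D₅(x, a)` of the first kind, as a function of `x`. -/
def dicksonFive {F : Type*} [CommRing F] (a x : F) : F := x ^ 5 - 5 * a * x ^ 3 + 5 * a ^ 2 * x

open Polynomial in
/-- The polynomial `c * D₅(X + b, a) + d` in expanded form. -/
noncomputable def affineDicksonFive (a b c d : F) : F[X] :=
  C c * X ^ 5 + C (c * (5 * b)) * X ^ 4 + C (c * (10 * b ^ 2 - 5 * a)) * X ^ 3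
    + C (c * (10 * b ^ 3 - 15 * a * b)) * X ^ 2
    + C (c * (5 * b ^ 4 - 15 * a * b ^ 2 + 5 * a ^ 2)) * X
    + C (c * dicksonFive a b + d)

theorem eval_affineDicksonFive (a b c d x : F) :
    (affineDicksonFive a b c d).eval x = c * dicksonFive a (x + b) + d := by
  simp only [affineDicksonFive, dicksonFive, Polynomial.eval_add, Polynomial.eval_mul,
    Polynomial.eval_C, Polynomial.eval_pow, Polynomial.eval_X]
  ring

theorem natDegree_affineDicksonFive_le (a b c d : F) :
    (affineDicksonFive a b c d).natDegree ≤ 5 := by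
  unfold affineDicksonFive
  compute_degree

theorem affineDicksonFive_inj (h5 : (5 : F) ≠ 0) {a b c d a' b' c' d' : F} (hc : c ≠ 0)
    (h : affineDicksonFive a b c d = affineDicksonFive a' b' c' d') :
    a = a' ∧ b = b' ∧ c = c' ∧ d = d' := by
  have hcoeff (n : ℕ) := congrArg (fun p => Polynomial.coeff p n) h
  have e5 := hcoeff 5
  have e4 := hcoeff 4
  have e3 := hcoeff 3
  have e0 := hcoeff 0
  simp only [affineDicksonFive, Polynomial.coeff_add, Polynomial.coeff_C_mul, Polynomial.coeff_X,
    Polynomial.coeff_C, Polynomial.coeff_X_pow] at e5 e4 e3 e0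
  norm_num at e5 e4 e3 e0
  subst e5
  obtain rfl : b = b' := by simpa [hc, h5] using e4
  obtain rfl : a = a' := by simpa [hc, h5] using e3
  simpa using e0

end Dickson

instance fact_prime_forty_three : Fact (Nat.Prime 43) := ⟨by norm_num⟩

theorem dicksonFive_injective_of_lt_five (a : Fin 5) :
    Function.Injective (dicksonFive (a.val : ZMod 43)) := by
  have h : ∀ a : Fin 5, ∀ x y : ZMod 43,
      x ^ 5 - 5 * (a.val : ZMod 43) * x ^ 3 + 5 * (a.val : ZMod 43) ^ 2 * x =
        y ^ 5 - 5 * (a.val : ZMod 43) * y ^ 3 + 5 * (a.val : ZMod 43) ^ 2 * y → x = y := by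
    decide +kernel
  exact fun x y hxy => h a x y hxy

theorem affineDicksonFive_eval_injective (a : Fin 5) (b : ZMod 43) (c : (ZMod 43)ˣ)
    (d : ZMod 43) :
    Function.Injective fun x => (affineDicksonFive (a.val : ZMod 43) b c d).eval x := by
  intro x y hxy
  have hdickson : dicksonFive (a.val : ZMod 43) (x + b) = dicksonFive (a.val : ZMod 43) (y + b) := by
    simpa [eval_affineDicksonFive] using hxy
  exact add_right_cancel (dicksonFive_injective_of_lt_five a hdickson)

/-- The permutation `x ↦ c * D₅(x + b, a) + d` of `ZMod 43`. -/
noncomputable def dicksonPerm (i : Fin 5 × ZMod 43 × (ZMod 43)ˣ × ZMod 43) :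
    Equiv.Perm (ZMod 43) :=
  Equiv.ofBijective _
    (Finite.injective_iff_bijective.mp (affineDicksonFive_eval_injective i.1 i.2.1 i.2.2.1 i.2.2.2))

theorem hammingDist_dicksonPerm {i j : Fin 5 × ZMod 43 × (ZMod 43)ˣ × ZMod 43} (hij : i ≠ j) :
    38 ≤ hammingDist ⇑(dicksonPerm i) ⇑(dicksonPerm j) := by
  obtain ⟨a, b, c, d⟩ := i
  obtain ⟨a', b', c', d'⟩ := j
  have hne : affineDicksonFive (a.val : ZMod 43) b c d ≠ affineDicksonFive (a'.val : ZMod 43) b' c' d' := by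
    intro h
    obtain ⟨ha, hb, hc, hd⟩ := affineDicksonFive_inj (by decide) c.ne_zero h
    have ha' : a = a' := by
      rw [ZMod.natCast_eq_natCast_iff'] at ha
      omega
    exact hij (by rw [ha', hb, Units.ext hc, hd])
  have hdist := card_sub_le_hammingDist_eval (natDegree_affineDicksonFive_le _ _ _ _)
    (natDegree_affineDicksonFive_le _ _ _ _) hne
  rw [ZMod.card] at hdist
  exact hdist

theorem dicksonPerm_injective : Function.Injective dicksonPerm := by
  intro i j h
  by_contra hij
  simpa [h] using hammingDist_dicksonPerm hij

theorem exists_perm_zmod_hammingDist_ge {m : ℕ} (hm : m ≤ 388290) :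
    ∃ S : Finset (Equiv.Perm (ZMod 43)), S.card = m ∧
      ∀ σ ∈ S, ∀ τ ∈ S, σ ≠ τ → 38 ≤ hammingDist ⇑σ ⇑τ := by
  have hcard : (Finset.univ : Finset (Fin 5 × ZMod 43 × (ZMod 43)ˣ × ZMod 43)).card = 388290 := by
    rw [Finset.card_univ]
    simp only [Fintype.card_prod, Fintype.card_fin, ZMod.card, ZMod.card_units]
  obtain ⟨T, -, hT⟩ := Finset.exists_subset_card_eq (hm.trans_eq hcard.symm)
  refine ⟨T.map ⟨dicksonPerm, dicksonPerm_injective⟩, (Finset.card_map _).trans hT, ?_⟩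
  intro σ hσ τ hτ hne
  obtain ⟨i, -, rfl⟩ := Finset.mem_map.mp hσ
  obtain ⟨j, -, rfl⟩ := Finset.mem_map.mp hτ
  exact hammingDist_dicksonPerm (ne_of_apply_ne dicksonPerm hne)

/-- `M(43, 37) ≥ 369948`: there exists a set of 369948 permutations of `Z_43` whose pairwise
Hamming distance is at least 37. -/
theorem M_43_37_ge_369948 :
    ∃ S : Finset (Equiv.Perm (Fin 43)), S.card = 369948 ∧
      ∀ σ ∈ S, ∀ τ ∈ S, σ ≠ τ → 37 ≤ hammingDist ⇑σ ⇑τ := by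
  obtain ⟨S, hcard, hdist⟩ := exists_perm_zmod_hammingDist_ge (m := 369948) (by norm_num)
  exact ⟨S, hcard, fun σ hσ τ hτ hne => (Nat.le_succ 37).trans (hdist σ hσ τ hτ hne)⟩
end
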